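/- arXiv:2507.01672 — 4 statements merged into one kernel-verified Lean document; each statement's English description precedes it below -/
import Mathlib

section
/- Let n ≥ 2 and let f ∈ ℂ[x_0,…,x_n] be a homogeneous polynomial of degree 2. Then the following are equivalent: (i) there exist homogeneous linear forms l_{11}, l_{12}, l_{21}, l_{22} ∈ ℂ[x_0,…,x_n] such that f = l_{11}·l_{22} − l_{12}·l_{21} (i.e., f is the determinant of a 2×2 matrix of linear forms); (ii) there exists a linear subspace W ⊆ ℂ^{n+1} with dim W = n − 1 such that f vanishes at every point of W (i.e., the quadric hypersurface V(f) ⊆ ℙⁿ contains a linear subspace of projective dimension n − 2). -/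
namespace MvPolynomial

variable {K σ : Type*} [Field K] [Fintype σ]

/-- Evaluation of a homogeneous polynomial of degree one is a linear functional. -/
lemma IsHomogeneous.exists_linearMap_eval_eq {l : MvPolynomial σ K} (hl : l.IsHomogeneous 1) :
    ∃ φ : (σ → K) →ₗ[K] K, ∀ x, eval x l = φ x := by
  have hc : ∀ i, ∃ c, pderiv i l = C c := fun i =>
    ⟨_, by simpa [← totalDegree_zero_iff_isHomogeneous, totalDegree_eq_zero_iff_eq_C]
      using hl.pderiv (i := i)⟩
  choose c hc using hc
  refine ⟨∑ i, c i • LinearMap.proj i, fun x => ?_⟩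
  have h := congrArg (eval x) hl.sum_X_mul_pderiv
  simp only [hc, one_smul, map_sum, map_mul, eval_X, eval_C] at h
  simp [← h, mul_comm]

/-- Every linear functional is the evaluation of a homogeneous polynomial of degree one. -/
lemma exists_isHomogeneous_one_eval_eq (φ : (σ → K) →ₗ[K] K) :
    ∃ l : MvPolynomial σ K, l.IsHomogeneous 1 ∧ ∀ x, eval x l = φ x := by
  classical
  refine ⟨∑ i, C (φ (Pi.single i 1)) * X i, ?_, fun x => ?_⟩
  · exact IsHomogeneous.sum _ _ _ fun i _ => by
      simpa using (isHomogeneous_C σ (φ (Pi.single i 1))).mul (isHomogeneous_X K i)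
  · conv_rhs => rw [pi_eq_sum_univ' x]
    simp [mul_comm]

/-- A homogeneous polynomial of degree two evaluates as a bilinear form on the diagonal. -/
lemma IsHomogeneous.exists_bilin_eval_eq [CharZero K] {f : MvPolynomial σ K}
    (hf : f.IsHomogeneous 2) :
    ∃ B : (σ → K) →ₗ[K] (σ → K) →ₗ[K] K, ∀ x, eval x f = B x x := by
  choose φ hφ using fun i => (hf.pderiv (i := i)).exists_linearMap_eval_eq
  refine ⟨(2⁻¹ : K) • ∑ i, (LinearMap.proj i).smulRight (φ i), fun x => ?_⟩
  have h := congrArg (eval x) hf.sum_X_mul_pderiv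
  simp only [map_sum, map_mul, eval_X, hφ, map_nsmul] at h
  simp [h]

end MvPolynomial

/-- A subspace contains subspaces of every dimension up to its own. -/
lemma Submodule.exists_le_finrank_eq {K V : Type*} [Field K] [AddCommGroup V] [Module K V]
    (U : Submodule K V) {m : ℕ} (hm : m ≤ Module.finrank K U) :
    ∃ W ≤ U, Module.finrank K W = m := by
  obtain ⟨v, hv⟩ := exists_linearIndependent_of_le_finrank hm
  refine ⟨span K (Set.range fun i => (v i : V)), ?_, ?_⟩
  · rw [span_le]
    rintro _ ⟨i, rfl⟩
    exact (v i).2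
  · exact (finrank_span_eq_card (hv.map' U.subtype U.ker_subtype)).trans (Fintype.card_fin m)

/-- A bilinear form vanishing on the diagonal of a subspace of codimension two is, on the
diagonal, a combination of two products of linear functionals. -/
lemma LinearMap.exists_diag_eq_of_finrank_quotient_eq_two {K V : Type*} [Field K]
    [AddCommGroup V] [Module K V] [FiniteDimensional K V] (B : V →ₗ[K] V →ₗ[K] K)
    (W : Submodule K V) (hW : Module.finrank K (V ⧸ W) = 2) (hB : ∀ x ∈ W, B x x = 0) :
    ∃ a b c d : V →ₗ[K] K, ∀ x, B x x = a x * b x + c x * d x := by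
  let e := Module.finBasisOfFinrankEq K (V ⧸ W) hW
  choose u hu using fun i => W.mkQ_surjective (e i)
  let a : Fin 2 → V →ₗ[K] K := fun i => e.coord i ∘ₗ W.mkQ
  let p : V →ₗ[K] V := LinearMap.id - ∑ i, (a i).smulRight (u i)
  have hp : ∀ x, p x ∈ W := fun x => by
    rw [← W.ker_mkQ, LinearMap.mem_ker]
    have h := e.sum_repr (W.mkQ x)
    simp only [p, LinearMap.sub_apply, LinearMap.id_apply, LinearMap.sum_apply,
      LinearMap.smulRight_apply, map_sub, map_sum, map_smul, hu]
    exact sub_eq_zero.mpr h.symm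
  have hx : ∀ x, x = p x + (a 0 x • u 0 + a 1 x • u 1) := fun x => by
    simp [p, Fin.sum_univ_two]
  refine ⟨a 0, B.flip (u 0) ∘ₗ p + B (u 0), a 1, B.flip (u 1) ∘ₗ p + B (u 1), fun x => ?_⟩
  have h1 : B x x = B (p x) x + a 0 x * B (u 0) x + a 1 x * B (u 1) x := by
    have := congrArg (fun y => B y x) (hx x)
    simpa [add_assoc] using this
  have h2 : B (p x) x = a 0 x * B (p x) (u 0) + a 1 x * B (p x) (u 1) := by
    have := congrArg (B (p x)) (hx x)
    simpa [hB _ (hp x)] using this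
  rw [h1, h2]
  simp only [LinearMap.add_apply, LinearMap.comp_apply, LinearMap.flip_apply]
  ring

theorem stmt_0 (n : ℕ) (hn : 2 ≤ n) (f : MvPolynomial (Fin (n + 1)) ℂ)
    (hf : f.IsHomogeneous 2) :
    (∃ l11 l12 l21 l22 : MvPolynomial (Fin (n + 1)) ℂ,
        l11.IsHomogeneous 1 ∧ l12.IsHomogeneous 1 ∧ l21.IsHomogeneous 1 ∧
        l22.IsHomogeneous 1 ∧ f = l11 * l22 - l12 * l21) ↔
      (∃ W : Submodule ℂ (Fin (n + 1) → ℂ), Module.finrank ℂ W = n - 1 ∧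
        ∀ x ∈ W, MvPolynomial.eval x f = 0) := by
  constructor
  · rintro ⟨l11, l12, l21, l22, h11, h12, -, -, rfl⟩
    obtain ⟨φ, hφ⟩ := h11.exists_linearMap_eval_eq
    obtain ⟨ψ, hψ⟩ := h12.exists_linearMap_eval_eq
    have hdim : n - 1 ≤ Module.finrank ℂ (LinearMap.ker (φ.prod ψ)) := by
      have h := (φ.prod ψ).finrank_range_add_finrank_ker
      have hr := (LinearMap.range (φ.prod ψ)).finrank_le
      simp only [Module.finrank_prod, Module.finrank_self, Module.finrank_fin_fun] at h hr
      omega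
    obtain ⟨W, hWle, hW⟩ := Submodule.exists_le_finrank_eq _ hdim
    refine ⟨W, hW, fun x hx => ?_⟩
    have hk := hWle hx
    rw [LinearMap.ker_prod, Submodule.mem_inf, LinearMap.mem_ker, LinearMap.mem_ker] at hk
    simp [hφ, hψ, hk.1, hk.2]
  · rintro ⟨W, hW, hfW⟩
    obtain ⟨B, hB⟩ := hf.exists_bilin_eval_eq
    have hq : Module.finrank ℂ ((Fin (n + 1) → ℂ) ⧸ W) = 2 := by
      have h := W.finrank_quotient_add_finrank
      rw [Module.finrank_fin_fun] at h
      omega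
    obtain ⟨a, b, c, d, h⟩ := B.exists_diag_eq_of_finrank_quotient_eq_two W hq
      fun x hx => by rw [← hB, hfW x hx]
    obtain ⟨la, ha, ha'⟩ := MvPolynomial.exists_isHomogeneous_one_eval_eq a
    obtain ⟨lb, hb, hb'⟩ := MvPolynomial.exists_isHomogeneous_one_eval_eq b
    obtain ⟨lc, hc, hc'⟩ := MvPolynomial.exists_isHomogeneous_one_eval_eq c
    obtain ⟨ld, hd, hd'⟩ := MvPolynomial.exists_isHomogeneous_one_eval_eq d
    refine ⟨la, -lc, ld, lb, ha, hc.neg, hd, hb, MvPolynomial.funext fun x => ?_⟩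
    simp [hB, h, ha', hb', hc', hd']
end

section
/- Let f = 2x_0x_2 + 3x_1x_2 + x_2² + 2x_0x_3 + 5x_1x_3 + 2x_2x_3 + 3x_1x_4 + 2x_2x_4 ∈ ℂ[x_0, x_1, x_2, x_3, x_4]. Then: (a) the quadric threefold V(f) ⊆ ℙ⁴ is smooth, i.e., there is no nonzero p ∈ ℂ⁵ at which all five partial derivatives of f vanish; and (b) f admits no determinantal representation, i.e., there are no homogeneous linear forms a, b, c, d ∈ ℂ[x_0,…,x_4] with f = a·d − b·c. -/
open MvPolynomial

/-- The adjoint polynomial of the polytope from Example `ex:counter`: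
`f = 2x₀x₂ + 3x₁x₂ + x₂² + 2x₀x₃ + 5x₁x₃ + 2x₂x₃ + 3x₁x₄ + 2x₂x₄`. -/
noncomputable def f3 : MvPolynomial (Fin 5) ℂ :=
  2 * X 0 * X 2 + 3 * X 1 * X 2 + X 2 ^ 2 + 2 * X 0 * X 3 + 5 * X 1 * X 3 +
    2 * X 2 * X 3 + 3 * X 1 * X 4 + 2 * X 2 * X 4

/-- A linear form acts on points as a linear functional. -/
lemma exists_linearMap_eq_eval_of_isHomogeneous_one {σ R : Type*} [Fintype σ] [CommRing R]
    {a : MvPolynomial σ R} (ha : a.IsHomogeneous 1) :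
    ∃ l : (σ → R) →ₗ[R] R, ∀ p, l p = eval p a := by
  refine ⟨∑ i, coeff 0 (pderiv i a) • LinearMap.proj i, fun p => ?_⟩
  have hconst (i : σ) : pderiv i a = C (coeff 0 (pderiv i a)) :=
    totalDegree_eq_zero_iff_eq_C.mp (Nat.le_zero.mp ha.pderiv.totalDegree_le)
  have heuler := congrArg (eval p) ha.sum_X_mul_pderiv
  simp only [map_sum, map_mul, eval_X, one_smul] at heuler
  rw [← heuler, LinearMap.sum_apply]
  refine Finset.sum_congr rfl fun i _ => ?_
  rw [hconst i]
  simp [mul_comm]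

/-- Four linear forms in five variables have a nontrivial common zero. -/
lemma exists_ne_zero_common_zero {a : Fin 4 → MvPolynomial (Fin 5) ℂ}
    (ha : ∀ j, (a j).IsHomogeneous 1) :
    ∃ p : Fin 5 → ℂ, p ≠ 0 ∧ ∀ j, eval p (a j) = 0 := by
  choose l hl using fun j => exists_linearMap_eq_eval_of_isHomogeneous_one (ha j)
  have hker : LinearMap.ker (LinearMap.pi l) ≠ ⊥ :=
    LinearMap.ker_ne_bot_of_finrank_lt (by simp)
  obtain ⟨p, hp, hp0⟩ := Submodule.exists_mem_ne_zero_of_ne_bot hker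
  exact ⟨p, hp0, fun j => by rw [← hl]; exact congrFun (LinearMap.mem_ker.mp hp) j⟩

/-- A determinant of size two is singular at every common zero of its entries. -/
lemma eval_pderiv_mul_sub_mul_eq_zero {σ R : Type*} [CommRing R]
    {a b c d : MvPolynomial σ R} {p : σ → R} (ha : eval p a = 0) (hb : eval p b = 0)
    (hc : eval p c = 0) (hd : eval p d = 0) (i : σ) :
    eval p (pderiv i (a * d - b * c)) = 0 := by
  simp [ha, hb, hc, hd]

/-- The quadric cut out by `f3` is smooth. -/
lemma eq_zero_of_eval_pderiv_f3_eq_zero (p : Fin 5 → ℂ) (hp : ∀ i, eval p (pderiv i f3) = 0) : p = 0 := by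
  have h2 (i : Fin 5) : pderiv i (2 : MvPolynomial (Fin 5) ℂ) = 0 := pderiv_C (a := 2)
  have h3 (i : Fin 5) : pderiv i (3 : MvPolynomial (Fin 5) ℂ) = 0 := pderiv_C (a := 3)
  have h5 (i : Fin 5) : pderiv i (5 : MvPolynomial (Fin 5) ℂ) = 0 := pderiv_C (a := 5)
  have e0 := hp 0
  have e1 := hp 1
  have e2 := hp 2
  have e3 := hp 3
  have e4 := hp 4
  simp [f3, pderiv_X, h2, h3, h5] at e0 e1 e2 e3 e4
  have z2 : p 2 = 0 := by grind
  ext i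
  fin_cases i <;> simp <;> grind

theorem stmt_3 :
    (¬ ∃ p : Fin 5 → ℂ, p ≠ 0 ∧ ∀ i : Fin 5, eval p (pderiv i f3) = 0) ∧
    (¬ ∃ a b c d : MvPolynomial (Fin 5) ℂ,
        a.IsHomogeneous 1 ∧ b.IsHomogeneous 1 ∧ c.IsHomogeneous 1 ∧ d.IsHomogeneous 1 ∧
        f3 = a * d - b * c) := by
  refine ⟨fun ⟨p, hp0, hp⟩ => hp0 (eq_zero_of_eval_pderiv_f3_eq_zero p hp), ?_⟩
  rintro ⟨a, b, c, d, ha, hb, hc, hd, hf⟩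
  obtain ⟨p, hp0, hp⟩ := exists_ne_zero_common_zero (a := ![a, b, c, d])
    (fun j => by fin_cases j <;> assumption)
  refine hp0 (eq_zero_of_eval_pderiv_f3_eq_zero p fun i => ?_)
  rw [hf]
  exact eval_pderiv_mul_sub_mul_eq_zero (hp 0) (hp 1) (hp 2) (hp 3) i
end

section
/- Let P = conv(v_1,…,v_n), n ≥ 4, be a convex polygon as in the context, with adjoint polynomial α_P. Then there exist an (n−3)×(n−3) symmetric matrix M whose entries are real polynomials of degree at most 1 in x = (x_1, x_2) and nonzero real numbers c_1, …, c_{n−3} such that: (i) M is tridiagonal, i.e., the (i,j) entry of M is the zero polynomial whenever |i − j| ≥ 2; (ii) for every 1 ≤ k ≤ n−3, the determinant of the leading k×k submatrix of M equals c_k · α_{P_k}, where P_k = conv(v_1, …, v_{k+3}) is the subpolygon on the first k+3 vertices (so in particular det M = c_{n−3} · α_P); and (iii) for every point a in the interior of P, the real symmetric matrix M(a) is positive definite. -/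
open MvPolynomial

/-- The affine-linear form `l(x) = c + w₀ x₁ + w₁ x₂` with inward normal `w`. -/
noncomputable def linForm (w : Fin 2 → ℝ) (c : ℝ) : MvPolynomial (Fin 2) ℝ :=
  C c + C (w 0) * X 0 + C (w 1) * X 1

/-- Determinant of the 2×2 matrix with columns `a`, `b`. -/
def det2 (a b : Fin 2 → ℝ) : ℝ := a 0 * b 1 - a 1 * b 0

/-- Warren's adjoint polynomial of an `m`-gon with facet data `(w, c)` (indices `0,…,m-1`
read cyclically): `α(x) = Σᵢ det(wᵢ, wᵢ₊₁) Π_{j ∉ {i,i+1}} lⱼ(x)`. -/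
noncomputable def adjPoly (m : ℕ) (w : ℕ → Fin 2 → ℝ) (c : ℕ → ℝ) :
    MvPolynomial (Fin 2) ℝ :=
  ∑ i ∈ Finset.range m, C (det2 (w i) (w ((i + 1) % m))) *
    ∏ j ∈ ((Finset.range m).erase i).erase ((i + 1) % m), linForm (w j) (c j)

/-- `v 0, …, v (m-1)` are the vertices, in counterclockwise order, of a convex `m`-gon in
which every `v i` is a vertex, and for each `i` the affine-linear form
`lᵢ = linForm (w i) (c i)` vanishes on the edge from `v (i-1)` to `v i` and is strictly
positive at all the other vertices (hence on the interior of the polygon); counterclockwise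
orientation is recorded by `det(wᵢ, wᵢ₊₁) > 0`. -/
structure IsPolygonData (m : ℕ) (v w : ℕ → Fin 2 → ℝ) (c : ℕ → ℝ) : Prop where
  three_le : 3 ≤ m
  vanish_prev : ∀ i < m, eval (v ((i + m - 1) % m)) (linForm (w i) (c i)) = 0
  vanish_self : ∀ i < m, eval (v i) (linForm (w i) (c i)) = 0
  pos_other : ∀ i < m, ∀ j < m, j ≠ (i + m - 1) % m → j ≠ i →
    0 < eval (v j) (linForm (w i) (c i))
  ccw : ∀ i < m, 0 < det2 (w i) (w ((i + 1) % m))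

/-- `p` is (a representative of) the adjoint polynomial of the convex `m`-gon with
vertices `v 0, …, v (m-1)`, for some admissible choice of facet forms. -/
def IsAdjointOf (m : ℕ) (v : ℕ → Fin 2 → ℝ) (p : MvPolynomial (Fin 2) ℝ) : Prop :=
  ∃ w c, IsPolygonData m v w c ∧ p = adjPoly m w c

/-- Entries of the symmetric tridiagonal matrix with diagonal `a` and off-diagonal `b`. -/
def tridiagEntry {R : Type*} [Zero R] (a b : ℕ → R) (i j : ℕ) : R :=
  if i = j then a i else if i + 1 = j then b i else if j + 1 = i then b j else 0

/-- The `k × k` symmetric tridiagonal matrix with diagonal `a` and off-diagonal `b`. -/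
def tridiag {R : Type*} [Zero R] (a b : ℕ → R) (k : ℕ) : Matrix (Fin k) (Fin k) R :=
  Matrix.of fun i j => tridiagEntry a b i j

theorem tridiagEntry_symm {R : Type*} [Zero R] (a b : ℕ → R) (i j : ℕ) :
    tridiagEntry a b i j = tridiagEntry a b j i := by
  unfold tridiagEntry
  split_ifs <;> first | omega | (subst_vars; rfl)

theorem tridiag_isSymm {R : Type*} [Zero R] (a b : ℕ → R) (k : ℕ) : (tridiag a b k).IsSymm :=
  Matrix.IsSymm.ext fun i j => tridiagEntry_symm a b j i

theorem tridiagEntry_self {R : Type*} [Zero R] (a b : ℕ → R) (i : ℕ) :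
    tridiagEntry a b i i = a i := by
  simp [tridiagEntry]

theorem tridiagEntry_succ {R : Type*} [Zero R] (a b : ℕ → R) (i : ℕ) :
    tridiagEntry a b i (i + 1) = b i := by
  simp [tridiagEntry]

theorem tridiagEntry_of_lt {R : Type*} [Zero R] (a b : ℕ → R) {i j : ℕ} (h : i + 1 < j) :
    tridiagEntry a b i j = 0 := by
  rw [tridiagEntry, if_neg (by omega), if_neg (by omega), if_neg (by omega)]

theorem tridiag_apply {R : Type*} [Zero R] (a b : ℕ → R) {k : ℕ} (i j : Fin k) :
    tridiag a b k i j = tridiagEntry a b i j :=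
  rfl

/-- The continuant recurrence for leading minors of a symmetric tridiagonal matrix. -/
theorem det_tridiag_add_two {R : Type*} [CommRing R] (a b : ℕ → R) (k : ℕ) :
    (tridiag a b (k + 2)).det =
      a (k + 1) * (tridiag a b (k + 1)).det - b k ^ 2 * (tridiag a b k).det := by
  rw [Matrix.det_succ_row _ (Fin.last (k + 1)), Fin.sum_univ_castSucc, Fin.sum_univ_castSucc,
    Finset.sum_eq_zero]
  · have h1 : ((tridiag a b (k + 2)).submatrix (Fin.last (k + 1)).succAbove
        (Fin.last (k + 1)).succAbove) = tridiag a b (k + 1) := by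
      ext i j; simp [tridiag, Fin.succAbove_last]
    have h2 : ((tridiag a b (k + 2)).submatrix (Fin.last (k + 1)).succAbove
        (Fin.last k).castSucc.succAbove).det = b k * (tridiag a b k).det := by
      rw [Matrix.det_succ_column _ (Fin.last k), Fin.sum_univ_castSucc, Finset.sum_eq_zero]
      · have h3 : ((tridiag a b (k + 2)).submatrix (Fin.last (k + 1)).succAbove
          (Fin.last k).castSucc.succAbove).submatrix (Fin.last k).succAbove
            (Fin.last k).succAbove = tridiag a b k := by
          ext i j
          simp [tridiag, Fin.succAbove_last, Fin.succAbove_of_castSucc_lt, Fin.lt_def]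
        rw [h3]
        simp [tridiag_apply, tridiagEntry_succ, ← two_mul]
      · intro i _
        have : tridiagEntry a b i (k + 1) = 0 := tridiagEntry_of_lt a b (by have := i.isLt; omega)
        simp [tridiag_apply, this]
    have e : (-1 : R) ^ (k + 1 + k) = -1 := by
      rw [show k + 1 + k = 2 * k + 1 by ring, pow_succ, pow_mul]; simp
    have e' : (-1 : R) ^ (k + 1 + (k + 1)) = 1 := by
      rw [show k + 1 + (k + 1) = 2 * (k + 1) by ring, pow_mul]; simp
    rw [h1, h2, tridiag_apply, tridiag_apply]
    simp only [Fin.val_last, Fin.val_castSucc, tridiagEntry_self, e, e',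
      tridiagEntry_symm a b (k + 1) k, tridiagEntry_succ]
    ring
  · intro i _
    have : tridiagEntry a b (k + 1) i = 0 := by
      rw [tridiagEntry_symm]
      exact tridiagEntry_of_lt a b (by have := i.isLt; omega)
    simp [tridiag_apply, this]

/-- The quadratic form of `tridiag a b k` in terms of sequences. -/
theorem tridiag_sum_succ (a b : ℕ → ℝ) (x : ℕ → ℝ) (k : ℕ) :
    ∑ i ∈ Finset.range (k + 2), ∑ j ∈ Finset.range (k + 2), x i * tridiagEntry a b i j * x j =
      (∑ i ∈ Finset.range (k + 1), ∑ j ∈ Finset.range (k + 1), x i * tridiagEntry a b i j * x j) +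
        2 * b k * x k * x (k + 1) + a (k + 1) * x (k + 1) ^ 2 := by
  have h : ∑ i ∈ Finset.range (k + 1), x i * tridiagEntry a b i (k + 1) * x (k + 1) =
      b k * x k * x (k + 1) := by
    rw [Finset.sum_eq_single k]
    · rw [tridiagEntry_succ]; ring
    · intro i hi hk
      have := Finset.mem_range.1 hi
      rw [tridiagEntry_of_lt a b (by omega)]; ring
    · simp
  have h' : ∑ i ∈ Finset.range (k + 1), x (k + 1) * tridiagEntry a b (k + 1) i * x i =
      b k * x k * x (k + 1) := by
    rw [← h]
    refine Finset.sum_congr rfl fun i _ => ?_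
    rw [tridiagEntry_symm]; ring
  rw [Finset.sum_range_succ]
  simp_rw [Finset.sum_range_succ _ (k + 1)]
  rw [Finset.sum_add_distrib, h, h']
  simp only [tridiagEntry, if_true]
  ring

theorem tridiag_sum_pos_aux (a b p : ℕ → ℝ) (k : ℕ) (h1 : p 1 = a 0 * p 0)
    (hrec : ∀ i < k, p (i + 2) = a (i + 1) * p (i + 1) - b i ^ 2 * p i)
    (hp : ∀ i ≤ k + 1, 0 < p i) (x : ℕ → ℝ) :
    p (k + 1) * x k ^ 2 ≤ p k * ∑ i ∈ Finset.range (k + 1), ∑ j ∈ Finset.range (k + 1),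
        x i * tridiagEntry a b i j * x j ∧
      ((∑ i ∈ Finset.range (k + 1), ∑ j ∈ Finset.range (k + 1),
        x i * tridiagEntry a b i j * x j) ≤ 0 → ∀ i ≤ k, x i = 0) := by
  have last : ∀ k s, 0 < p k → 0 < p (k + 1) → p (k + 1) * x k ^ 2 ≤ p k * s → s ≤ 0 →
      x k = 0 := by
    intro k s h0 h1 h2 h3
    have : p (k + 1) * x k ^ 2 ≤ 0 := h2.trans (mul_nonpos_of_nonneg_of_nonpos h0.le h3)
    have : x k ^ 2 ≤ 0 := by
      by_contra hc
      push Not at hc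
      exact absurd (mul_pos h1 hc) (not_lt.2 this)
    exact pow_eq_zero_iff (two_ne_zero) |>.1 (le_antisymm this (sq_nonneg _))
  induction k with
  | zero =>
    have key : p (0 + 1) * x 0 ^ 2 ≤ p 0 * ∑ i ∈ Finset.range (0 + 1),
        ∑ j ∈ Finset.range (0 + 1), x i * tridiagEntry a b i j * x j := by
      simp [tridiagEntry, h1]
      apply le_of_eq; ring
    refine ⟨key, fun h i hi => ?_⟩
    obtain rfl : i = 0 := by omega
    exact last 0 _ (hp 0 (by omega)) (hp 1 (by omega)) key h
  | succ k ih =>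
    obtain ⟨ih1, ih2⟩ := ih (fun i hi => hrec i (by omega)) (fun i hi => hp i (by omega))
    have hk := hp k (by omega)
    have hk1 := hp (k + 1) (by omega)
    have hk2 := hp (k + 2) (by omega)
    have hr := hrec k (by omega)
    rw [tridiag_sum_succ]
    set s := ∑ i ∈ Finset.range (k + 1), ∑ j ∈ Finset.range (k + 1),
        x i * tridiagEntry a b i j * x j
    have key : p (k + 1 + 1) * x (k + 1) ^ 2 ≤
        p (k + 1) * (s + 2 * b k * x k * x (k + 1) + a (k + 1) * x (k + 1) ^ 2) := by
      refine le_of_mul_le_mul_left ?_ hk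
      have e := mul_le_mul_of_nonneg_left ih1 hk1.le
      have hr' : a (k + 1) * p (k + 1) = p (k + 2) + b k ^ 2 * p k := by rw [hr]; ring
      have sq := sq_nonneg (p (k + 1) * x k + p k * b k * x (k + 1))
      have : p k * (p (k + 1) * (s + 2 * b k * x k * x (k + 1) + a (k + 1) * x (k + 1) ^ 2)) =
          p (k + 1) * (p k * s) + 2 * p k * p (k + 1) * b k * x k * x (k + 1) +
            p k * (a (k + 1) * p (k + 1)) * x (k + 1) ^ 2 := by ring
      rw [this, hr']
      show p k * (p (k + 2) * _) ≤ _
      nlinarith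
    refine ⟨key, fun h => ?_⟩
    have h0 := last (k + 1) _ hk1 hk2 key h
    intro i hi
    rcases Nat.lt_or_ge i (k + 1) with hlt | hge
    · refine ih2 ?_ i (by omega)
      simpa [h0] using h
    · obtain rfl : i = k + 1 := by omega
      exact h0

/-- A real symmetric tridiagonal matrix whose continuant sequence `p` is positive is positive
definite. -/
theorem tridiag_posDef (a b p : ℕ → ℝ) (k : ℕ) (h1 : p 1 = a 0 * p 0)
    (hrec : ∀ i, i + 1 < k → p (i + 2) = a (i + 1) * p (i + 1) - b i ^ 2 * p i)
    (hp : ∀ i ≤ k, 0 < p i) : (tridiag a b k).PosDef := by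
  refine .of_dotProduct_mulVec_pos ?_ fun y hy => ?_
  · rw [Matrix.IsHermitian, Matrix.conjTranspose_eq_transpose_of_trivial]
    exact tridiag_isSymm a b k
  cases k with
  | zero => exact absurd (Subsingleton.elim _ _) hy
  | succ k =>
    let x : ℕ → ℝ := fun i => if h : i < k + 1 then y ⟨i, h⟩ else 0
    have hx : ∀ i : Fin (k + 1), y i = x i := fun i => by simp only [x, i.isLt, dif_pos]
    have e : star y ⬝ᵥ (tridiag a b (k + 1)).mulVec y = ∑ i ∈ Finset.range (k + 1),
        ∑ j ∈ Finset.range (k + 1), x i * tridiagEntry a b i j * x j := by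
      simp only [dotProduct, Matrix.mulVec, Finset.sum_range, Finset.mul_sum, tridiag, hx,
        Matrix.of_apply, Pi.star_apply, star_trivial, mul_assoc]
    rw [e]
    by_contra hc
    have := (tridiag_sum_pos_aux a b p k h1 (fun i hi => hrec i (by omega)) hp x).2 (not_lt.1 hc)
    refine hy (funext fun i => ?_)
    rw [hx]
    exact this i (by omega)

/-- Twice the signed area of the triangle `p q x`. -/
def orient (p q x : Fin 2 → ℝ) : ℝ :=
  (p 1 - q 1) * x 0 + (q 0 - p 0) * x 1 + (p 0 * q 1 - p 1 * q 0)

/-- The normal of the line from `p` to `q` pointing to its left, of length `|q - p|`. -/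
def edgeNormal (p q : Fin 2 → ℝ) : Fin 2 → ℝ := ![p 1 - q 1, q 0 - p 0]

/-- The constant term of the normalized form of the line from `p` to `q`. -/
def edgeConst (p q : Fin 2 → ℝ) : ℝ := p 0 * q 1 - p 1 * q 0

/-- The normalized affine-linear form of the line from `p` to `q`, positive on its left. -/
noncomputable def edgeForm (p q : Fin 2 → ℝ) : MvPolynomial (Fin 2) ℝ :=
  linForm (edgeNormal p q) (edgeConst p q)

theorem eval_linForm (w : Fin 2 → ℝ) (c : ℝ) (x : Fin 2 → ℝ) :
    eval x (linForm w c) = c + w 0 * x 0 + w 1 * x 1 := by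
  simp [linForm]

theorem eval_edgeForm (p q x : Fin 2 → ℝ) : eval x (edgeForm p q) = orient p q x := by
  simp [edgeForm, eval_linForm, orient, edgeNormal, edgeConst]; ring

theorem edgeForm_eq (p q : Fin 2 → ℝ) :
    edgeForm p q = (C (p 0) * C (q 1) - C (p 1) * C (q 0)) + (C (p 1) - C (q 1)) * X 0 +
      (C (q 0) - C (p 0)) * X 1 := by
  simp [edgeForm, linForm, edgeNormal, edgeConst]

theorem det2_edgeNormal (p q r : Fin 2 → ℝ) :
    det2 (edgeNormal p q) (edgeNormal q r) = orient p q r := by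
  simp [det2, edgeNormal, orient]; ring

theorem orient_rotate (p q r : Fin 2 → ℝ) : orient p q r = orient q r p := by
  unfold orient; ring

theorem orient_swap (p q r : Fin 2 → ℝ) : orient q p r = -orient p q r := by
  unfold orient; ring

theorem totalDegree_linForm_le (w : Fin 2 → ℝ) (c : ℝ) : (linForm w c).totalDegree ≤ 1 := by
  have h : ∀ (r : ℝ) (i : Fin 2), (C r * X i : MvPolynomial (Fin 2) ℝ).totalDegree ≤ 1 :=
    fun r i => (totalDegree_mul _ _).trans (by simp [totalDegree_C, totalDegree_X])
  refine (totalDegree_add _ _).trans (max_le ((totalDegree_add _ _).trans (max_le ?_ (h _ _))) (h _ _))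
  simp

/-- The side form of the line from `v j` to `v (j + 1)`. -/
noncomputable def side (v : ℕ → Fin 2 → ℝ) (j : ℕ) : MvPolynomial (Fin 2) ℝ :=
  edgeForm (v j) (v (j + 1))

/-- The diagonal form of the line from `v j` to `v 0`. -/
noncomputable def diag (v : ℕ → Fin 2 → ℝ) (j : ℕ) : MvPolynomial (Fin 2) ℝ :=
  edgeForm (v j) (v 0)

/-- The part of the adjoint of `conv (v 0, …, v (k + 1))` coming from the vertices other than
`v 0` and `v (k + 1)`, divided by the form of the closing edge. -/
noncomputable def chainSum (v : ℕ → Fin 2 → ℝ) : ℕ → MvPolynomial (Fin 2) ℝ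
  | 0 => 0
  | k + 1 => chainSum v k * side v (k + 1) +
      C (orient (v k) (v (k + 1)) (v (k + 2))) * ∏ j ∈ Finset.range k, side v j

/-- The adjoint of `conv (v 0, …, v (k + 1))` with respect to the normalized facet forms. -/
noncomputable def fan (v : ℕ → Fin 2 → ℝ) (k : ℕ) : MvPolynomial (Fin 2) ℝ :=
  chainSum v k * diag v (k + 1) +
    C (orient (v k) (v (k + 1)) (v 0)) * ∏ j ∈ Finset.range k, side v j +
    C (orient (v (k + 1)) (v 0) (v 1)) * ∏ j ∈ Finset.range k, side v (j + 1)

/-- Twice the signed area of the triangle `v 0, v (k + 1), v (k + 2)`. -/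
def area (v : ℕ → Fin 2 → ℝ) (k : ℕ) : ℝ := orient (v 0) (v (k + 1)) (v (k + 2))

theorem fan_zero (v : ℕ → Fin 2 → ℝ) : fan v 0 = 0 := by
  simp [fan, chainSum, orient]
  ring_nf

theorem fan_one (v : ℕ → Fin 2 → ℝ) : fan v 1 = C (area v 0 ^ 2) := by
  simp [fan, chainSum, orient, area, side, diag, edgeForm_eq]
  ring

theorem fan_succ_mul_diag (v : ℕ → Fin 2 → ℝ) (k : ℕ) :
    fan v (k + 1) * diag v (k + 1) = fan v k * diag v (k + 2) * side v (k + 1) -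
      C (area v k ^ 2) * ∏ j ∈ Finset.range (k + 1), side v j := by
  have h : (∏ j ∈ Finset.range k, side v (j + 1)) * side v 0 =
      (∏ j ∈ Finset.range k, side v j) * side v k := by
    rw [← Finset.prod_range_succ, ← Finset.prod_range_succ']
  simp only [fan, chainSum, Finset.prod_range_succ]
  generalize ∏ j ∈ Finset.range k, side v (j + 1) = Q at *
  generalize ∏ j ∈ Finset.range k, side v j = P at *
  generalize chainSum v k = S at *
  simp only [side, diag, orient, area, edgeForm_eq, C_mul, C_add, C_sub, C_pow, zero_add] at *
  generalize (C (v 0 0) : MvPolynomial (Fin 2) ℝ) = o0 at *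
  generalize (C (v 0 1) : MvPolynomial (Fin 2) ℝ) = o1 at *
  generalize (C (v 1 0) : MvPolynomial (Fin 2) ℝ) = i0 at *
  generalize (C (v 1 1) : MvPolynomial (Fin 2) ℝ) = i1 at *
  generalize (C (v k 0) : MvPolynomial (Fin 2) ℝ) = r0 at *
  generalize (C (v k 1) : MvPolynomial (Fin 2) ℝ) = r1 at *
  generalize (C (v (k + 1) 0) : MvPolynomial (Fin 2) ℝ) = p0 at *
  generalize (C (v (k + 1) 1) : MvPolynomial (Fin 2) ℝ) = p1 at *
  simp only [add_assoc, Nat.reduceAdd] at *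
  generalize (C (v (k + 2) 0) : MvPolynomial (Fin 2) ℝ) = q0 at *
  generalize (C (v (k + 2) 1) : MvPolynomial (Fin 2) ℝ) = q1 at *
  generalize (X 0 : MvPolynomial (Fin 2) ℝ) = x at *
  generalize (X 1 : MvPolynomial (Fin 2) ℝ) = y at *
  linear_combination (-((p1 - o1) * (o0 - q0) - (o0 - p0) * (q1 - o1)) *
    ((p0 * q1 - p1 * q0) + (p1 - q1) * x + (q0 - p0) * y)) * h

/-- The (scaled) diagonal entries of the determinantal representation. -/
noncomputable def diagEntry (v : ℕ → Fin 2 → ℝ) (k : ℕ) : MvPolynomial (Fin 2) ℝ :=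
  C (area v k * (area v k - orient (v 0) (v (k + 1)) (v (k + 3)))) * diag v (k + 3) +
    C (area v (k + 1) * (orient (v 0) (v (k + 1)) (v (k + 3)) - area v (k + 1))) * diag v (k + 1) +
    C (area v k * area v (k + 1) * orient (v 0) (v (k + 1)) (v (k + 3)))

theorem totalDegree_diagEntry_le (v : ℕ → Fin 2 → ℝ) (k : ℕ) :
    (diagEntry v k).totalDegree ≤ 1 := by
  have h : ∀ (r : ℝ) (j : ℕ), (C r * diag v j).totalDegree ≤ 1 := fun r j =>
    (totalDegree_mul _ _).trans (by
      rw [totalDegree_C, zero_add]; exact totalDegree_linForm_le _ _)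
  refine (totalDegree_add _ _).trans
    (max_le ((totalDegree_add _ _).trans (max_le (h _ _) (h _ _))) ?_)
  rw [totalDegree_C]
  exact Nat.zero_le _

theorem diag_mul_diagEntry (v : ℕ → Fin 2 → ℝ) (k : ℕ) :
    diag v (k + 2) * diagEntry v k =
      C (area v k ^ 2) * diag v (k + 3) * side v (k + 2) +
        C (area v (k + 1) ^ 2) * diag v (k + 1) * side v (k + 1) := by
  simp only [diagEntry, side, diag, orient, area, edgeForm_eq, C_mul, C_add, C_sub, C_pow,
    add_assoc, Nat.reduceAdd]
  ring

theorem area_mul_fan (v : ℕ → Fin 2 → ℝ) (k : ℕ) (h : area v (k + 1) ≠ 0) :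
    C (area v k ^ 2) * fan v (k + 2) = diagEntry v k * fan v (k + 1) -
      C (area v (k + 1) ^ 2) * side v (k + 1) ^ 2 * fan v k := by
  have hD : diag v (k + 2) ≠ 0 := by
    intro h0
    have := congrArg (eval (v (k + 3))) h0
    rw [diag, eval_edgeForm, orient_swap, map_zero, neg_eq_zero] at this
    exact h this
  refine mul_left_cancel₀ hD ?_
  have h1 := fan_succ_mul_diag v (k + 1)
  have h2 := fan_succ_mul_diag v k
  have h3 := diag_mul_diagEntry v k
  rw [Finset.prod_range_succ] at h1
  simp only [add_assoc, Nat.reduceAdd] at *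
  linear_combination C (area v k ^ 2) * h1 - C (area v (k + 1) ^ 2) * side v (k + 1) * h2 -
    fan v (k + 1) * h3

theorem prod_erase_erase_eq {M : Type*} [CommMonoid M] (s : Finset ℕ) (f : ℕ → M) (a b : ℕ) :
    ∏ j ∈ (s.erase a).erase b, f j = ∏ j ∈ s, if j = a ∨ j = b then 1 else f j := by
  rw [Finset.prod_ite, Finset.prod_const_one, one_mul]
  refine Finset.prod_congr ?_ fun _ _ => rfl
  ext j
  simp only [Finset.mem_erase, Finset.mem_filter]
  tauto

theorem chainSum_eq_sum (v : ℕ → Fin 2 → ℝ) (k : ℕ) :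
    chainSum v k = ∑ i ∈ Finset.range k, C (orient (v i) (v (i + 1)) (v (i + 2))) *
      ∏ j ∈ Finset.range (k + 1), if j = i ∨ j = i + 1 then 1 else side v j := by
  induction k with
  | zero => simp [chainSum]
  | succ k ih =>
    rw [chainSum, ih, Finset.sum_range_succ, Finset.sum_mul]
    congr 1
    · refine Finset.sum_congr rfl fun i hi => ?_
      have := Finset.mem_range.1 hi
      rw [Finset.prod_range_succ _ (k + 1), if_neg (by omega), mul_assoc]
    · rw [Finset.prod_range_succ, Finset.prod_range_succ, if_pos (by simp), if_pos (by simp)]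
      simp only [mul_one]
      congr 1
      refine Finset.prod_congr rfl fun j hj => ?_
      have := Finset.mem_range.1 hj
      rw [if_neg (by omega)]

/-- The adjoint of a cyclic list of facet forms `diag, side 0, …, side (k + 1)`. -/
theorem adjPoly_eq_fan (v w : ℕ → Fin 2 → ℝ) (c : ℕ → ℝ) (k : ℕ)
    (hw0 : w 0 = edgeNormal (v (k + 2)) (v 0)) (hc0 : c 0 = edgeConst (v (k + 2)) (v 0))
    (hw : ∀ i < k + 2, w (i + 1) = edgeNormal (v i) (v (i + 1)))
    (hc : ∀ i < k + 2, c (i + 1) = edgeConst (v i) (v (i + 1))) :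
    adjPoly (k + 3) w c = fan v (k + 1) := by
  have hL0 : linForm (w 0) (c 0) = diag v (k + 2) := by rw [hw0, hc0, diag, edgeForm]
  have hL : ∀ i < k + 2, linForm (w (i + 1)) (c (i + 1)) = side v i := fun i hi => by
    rw [hw i hi, hc i hi, side, edgeForm]
  have hnext : ∀ i, i < k + 2 → (i + 1) % (k + 3) = i + 1 := fun i hi =>
    Nat.mod_eq_of_lt (by omega)
  have hdet : ∀ i < k + 1, det2 (w (i + 1)) (w (i + 1 + 1)) =
      orient (v i) (v (i + 1)) (v (i + 2)) := fun i hi => by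
    rw [hw i (by omega), hw (i + 1) (by omega), det2_edgeNormal]
  have hmid : ∀ i ∈ Finset.range (k + 1), C (det2 (w (i + 1)) (w ((i + 1 + 1) % (k + 3)))) *
      ∏ j ∈ Finset.range (k + 3),
        (if j = i + 1 ∨ j = (i + 1 + 1) % (k + 3) then 1 else linForm (w j) (c j)) =
      C (orient (v i) (v (i + 1)) (v (i + 2))) * (∏ j ∈ Finset.range (k + 2),
        if j = i ∨ j = i + 1 then 1 else side v j) * diag v (k + 2) := by
    intro i hi
    have hi' := Finset.mem_range.1 hi
    rw [hnext (i + 1) (by omega), hdet i hi', Finset.prod_range_succ', if_neg (by omega), hL0,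
      mul_assoc]
    congr 2
    refine Finset.prod_congr rfl fun j hj => ?_
    rw [hL j (Finset.mem_range.1 hj)]
    simp only [Nat.add_right_cancel_iff]
  have hlast : C (det2 (w (k + 2)) (w ((k + 2 + 1) % (k + 3)))) *
      ∏ j ∈ Finset.range (k + 3),
        (if j = k + 2 ∨ j = (k + 2 + 1) % (k + 3) then 1 else linForm (w j) (c j)) =
      C (orient (v (k + 1)) (v (k + 2)) (v 0)) * ∏ j ∈ Finset.range (k + 1), side v j := by
    rw [show (k + 2 + 1) % (k + 3) = 0 from Nat.mod_self _, hw (k + 1) (by omega), hw0,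
      det2_edgeNormal, Finset.prod_range_succ, Finset.prod_range_succ', if_pos (Or.inr rfl),
      if_pos (Or.inl rfl), mul_one, mul_one]
    congr 1
    refine Finset.prod_congr rfl fun j hj => ?_
    have hj' := Finset.mem_range.1 hj
    rw [if_neg (by omega), hL j (by omega)]
  have hfirst : C (det2 (w 0) (w ((0 + 1) % (k + 3)))) *
      ∏ j ∈ Finset.range (k + 3),
        (if j = 0 ∨ j = (0 + 1) % (k + 3) then 1 else linForm (w j) (c j)) =
      C (orient (v (k + 2)) (v 0) (v 1)) * ∏ j ∈ Finset.range (k + 1), side v (j + 1) := by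
    rw [hnext 0 (by omega), hw 0 (by omega), hw0, det2_edgeNormal, Finset.prod_range_succ',
      Finset.prod_range_succ', if_pos (Or.inl rfl), if_pos (Or.inr rfl), mul_one, mul_one]
    congr 1
    refine Finset.prod_congr rfl fun j hj => ?_
    have hj' := Finset.mem_range.1 hj
    rw [if_neg (by omega), hL (j + 1) (by omega)]
  unfold adjPoly
  simp only [prod_erase_erase_eq]
  rw [Finset.sum_range_succ, Finset.sum_range_succ', Finset.sum_congr rfl hmid, hlast, hfirst,
    fan, chainSum_eq_sum, Finset.sum_mul, add_right_comm]

/-- The adjoint of `conv (v 0, …, v (k + 2))` for the normalized facet forms is `fan v (k + 1)`. -/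
theorem adjPoly_edgeNormal (v : ℕ → Fin 2 → ℝ) (k : ℕ) :
    adjPoly (k + 3) (fun i => edgeNormal (v ((i + (k + 3) - 1) % (k + 3))) (v i))
      (fun i => edgeConst (v ((i + (k + 3) - 1) % (k + 3))) (v i)) = fan v (k + 1) := by
  have hprev : ∀ i < k + 2, (i + 1 + (k + 3) - 1) % (k + 3) = i := fun i hi => by
    rw [show i + 1 + (k + 3) - 1 = i + (k + 3) by omega, Nat.add_mod_right,
      Nat.mod_eq_of_lt (by omega)]
  have hprev0 : (0 + (k + 3) - 1) % (k + 3) = k + 2 := by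
    rw [zero_add]; exact Nat.mod_eq_of_lt (by omega)
  refine adjPoly_eq_fan v _ _ k ?_ ?_ ?_ ?_
  · rw [hprev0]
  · rw [hprev0]
  · intro i hi
    rw [hprev i hi]
  · intro i hi
    rw [hprev i hi]

theorem linForm_smul (r : ℝ) (w : Fin 2 → ℝ) (c : ℝ) :
    linForm (r • w) (r * c) = C r * linForm w c := by
  simp [linForm]; ring

/-- Rescaling the facet forms rescales the adjoint. -/
theorem adjPoly_smul (m : ℕ) (hm : 2 ≤ m) (r : ℕ → ℝ) (w w' : ℕ → Fin 2 → ℝ) (c c' : ℕ → ℝ)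
    (hw : ∀ i < m, w' i = r i • w i) (hc : ∀ i < m, c' i = r i * c i) :
    adjPoly m w' c' = C (∏ i ∈ Finset.range m, r i) * adjPoly m w c := by
  unfold adjPoly
  rw [Finset.mul_sum]
  refine Finset.sum_congr rfl fun i hi => ?_
  have hi' := Finset.mem_range.1 hi
  have hs : (i + 1) % m < m := Nat.mod_lt _ (by omega)
  have hne : (i + 1) % m ≠ i := by
    rcases Nat.lt_or_ge (i + 1) m with h | h
    · rw [Nat.mod_eq_of_lt h]; omega
    · rw [show i + 1 = m by omega, Nat.mod_self]; omega
  have hprod : ∏ j ∈ ((Finset.range m).erase i).erase ((i + 1) % m), linForm (w' j) (c' j) =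
      C (∏ j ∈ ((Finset.range m).erase i).erase ((i + 1) % m), r j) *
        ∏ j ∈ ((Finset.range m).erase i).erase ((i + 1) % m), linForm (w j) (c j) := by
    rw [map_prod, ← Finset.prod_mul_distrib]
    refine Finset.prod_congr rfl fun j hj => ?_
    have hj' : j < m := Finset.mem_range.1 (Finset.mem_of_mem_erase (Finset.mem_of_mem_erase hj))
    rw [hw j hj', hc j hj', linForm_smul]
  rw [hprod, ← Finset.mul_prod_erase _ r hi,
    ← Finset.mul_prod_erase _ r (Finset.mem_erase.2 ⟨hne, Finset.mem_range.2 hs⟩),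
    hw i hi', hw _ hs]
  have : det2 (r i • w i) (r ((i + 1) % m) • w ((i + 1) % m)) =
      r i * r ((i + 1) % m) * det2 (w i) (w ((i + 1) % m)) := by
    simp [det2]; ring
  rw [this]
  simp only [C_mul]
  ring

theorem normSq_edgeNormal_pos {p q : Fin 2 → ℝ} (hpq : p ≠ q) :
    0 < (p 1 - q 1) ^ 2 + (q 0 - p 0) ^ 2 := by
  by_contra hc
  have h1 : (p 1 - q 1) ^ 2 = 0 := by nlinarith [sq_nonneg (p 1 - q 1), sq_nonneg (q 0 - p 0)]
  have h0 : (q 0 - p 0) ^ 2 = 0 := by nlinarith [sq_nonneg (p 1 - q 1), sq_nonneg (q 0 - p 0)]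
  refine hpq (funext fun i => ?_)
  fin_cases i
  · exact (sub_eq_zero.1 (pow_eq_zero_iff two_ne_zero |>.1 h0)).symm
  · exact sub_eq_zero.1 (pow_eq_zero_iff two_ne_zero |>.1 h1)

theorem exists_smul_edgeNormal {w p q : Fin 2 → ℝ} {c : ℝ} (hpq : p ≠ q)
    (hp : eval p (linForm w c) = 0) (hq : eval q (linForm w c) = 0) :
    ∃ r : ℝ, w = r • edgeNormal p q ∧ c = r * edgeConst p q := by
  rw [eval_linForm] at hp hq
  have hd := normSq_edgeNormal_pos hpq
  have hperp : w 0 * (q 0 - p 0) = w 1 * (p 1 - q 1) := by linarith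
  have hw : w = ((w 0 * (p 1 - q 1) + w 1 * (q 0 - p 0)) /
      ((p 1 - q 1) ^ 2 + (q 0 - p 0) ^ 2)) • edgeNormal p q := by
    funext i
    fin_cases i
    · simp [edgeNormal]
      field_simp
      linear_combination (q 0 - p 0) * hperp
    · simp [edgeNormal]
      field_simp
      linear_combination -(p 1 - q 1) * hperp
  refine ⟨_, hw, ?_⟩
  generalize (w 0 * (p 1 - q 1) + w 1 * (q 0 - p 0)) / ((p 1 - q 1) ^ 2 + (q 0 - p 0) ^ 2) = r at hw
  have h0 : w 0 = r * (p 1 - q 1) := by rw [hw]; simp [edgeNormal]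
  have h1 : w 1 = r * (q 0 - p 0) := by rw [hw]; simp [edgeNormal]
  rw [h0, h1] at hp
  rw [edgeConst]
  linear_combination hp

/-- The facet forms of a polygon are positive multiples of the normalized ones. -/
theorem IsPolygonData.exists_scaling {m : ℕ} {v w : ℕ → Fin 2 → ℝ} {c : ℕ → ℝ}
    (h : IsPolygonData m v w c) :
    ∃ r : ℕ → ℝ, ∀ i < m, 0 < r i ∧ w i = r i • edgeNormal (v ((i + m - 1) % m)) (v i) ∧
      c i = r i * edgeConst (v ((i + m - 1) % m)) (v i) := by
  have hm := h.three_le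
  have hcases : ∀ i < m, (i = 0 ∧ (i + m - 1) % m = m - 1 ∨ 0 < i ∧ (i + m - 1) % m = i - 1) ∧
      (i = m - 1 ∧ (i + 1) % m = 0 ∨ i < m - 1 ∧ (i + 1) % m = i + 1) := by
    intro i hi
    constructor
    · rcases Nat.eq_zero_or_pos i with h0 | h0
      · exact .inl ⟨h0, by rw [h0, zero_add]; exact Nat.mod_eq_of_lt (by omega)⟩
      · refine .inr ⟨h0, ?_⟩
        rw [show i + m - 1 = i - 1 + m by omega, Nat.add_mod_right, Nat.mod_eq_of_lt (by omega)]
    · rcases Nat.lt_or_ge (i + 1) m with h0 | h0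
      · exact .inr ⟨by omega, Nat.mod_eq_of_lt h0⟩
      · exact .inl ⟨by omega, by rw [show i + 1 = m by omega, Nat.mod_self]⟩
  have hprevlt : ∀ i < m, (i + m - 1) % m < m := fun i hi => Nat.mod_lt _ (by omega)
  have hnextlt : ∀ i < m, (i + 1) % m < m := fun i hi => Nat.mod_lt _ (by omega)
  have hprevnext : ∀ i < m, ((i + 1) % m + m - 1) % m = i := by
    intro i hi
    have h1 := (hcases i hi).2
    have h2 := (hcases _ (hnextlt i hi)).1
    omega
  have hne : ∀ i < m, v ((i + m - 1) % m) ≠ v i := by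
    intro i hi heq
    have h1 := hcases i hi
    have h3 := hcases _ (hnextlt i hi)
    have h2 := h.pos_other _ (hnextlt i hi) _ (hprevlt i hi) (by omega) (by omega)
    have h4 := h.vanish_prev _ (hnextlt i hi)
    rw [hprevnext i hi] at h4
    rw [heq, h4] at h2
    exact lt_irrefl _ h2
  have hex : ∀ i, ∃ r : ℝ, i < m → w i = r • edgeNormal (v ((i + m - 1) % m)) (v i) ∧
      c i = r * edgeConst (v ((i + m - 1) % m)) (v i) := by
    intro i
    by_cases hi : i < m
    · obtain ⟨r, hr⟩ := exists_smul_edgeNormal (hne i hi) (h.vanish_prev i hi) (h.vanish_self i hi)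
      exact ⟨r, fun _ => hr⟩
    · exact ⟨0, fun h => absurd h hi⟩
  choose r hr using hex
  have hnextpos : ∀ i < m, 0 < r ((i + 1) % m) := by
    intro i hi
    have h1 := hcases i hi
    have hp := h.pos_other i hi _ (hnextlt i hi) (by omega) (by omega)
    have hc := h.ccw i hi
    obtain ⟨hw1, hc1⟩ := hr i hi
    obtain ⟨hw2, -⟩ := hr _ (hnextlt i hi)
    rw [hprevnext i hi] at hw2
    rw [hw1, hc1, linForm_smul, eval_mul, eval_C, ← edgeForm, eval_edgeForm] at hp
    have : det2 (r i • edgeNormal (v ((i + m - 1) % m)) (v i))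
        (r ((i + 1) % m) • edgeNormal (v i) (v ((i + 1) % m))) =
        r ((i + 1) % m) * (r i * orient (v ((i + m - 1) % m)) (v i) (v ((i + 1) % m))) := by
      rw [← det2_edgeNormal]; simp [det2]; ring
    rw [hw1, hw2, this] at hc
    exact (pos_iff_pos_of_mul_pos hc).2 hp
  refine ⟨r, fun i hi => ⟨?_, hr i hi⟩⟩
  have h1 := hcases i hi
  have h2 := hcases _ (hprevlt i hi)
  have := hnextpos _ (hprevlt i hi)
  rwa [show ((i + m - 1) % m + 1) % m = i by omega] at this

theorem IsPolygonData.orient_pos {m : ℕ} {v w : ℕ → Fin 2 → ℝ} {c : ℕ → ℝ}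
    (h : IsPolygonData m v w c) {i j : ℕ} (hi : i < m) (hj : j < m) (h1 : j ≠ (i + m - 1) % m)
    (h2 : j ≠ i) : 0 < orient (v ((i + m - 1) % m)) (v i) (v j) := by
  obtain ⟨r, hr⟩ := h.exists_scaling
  obtain ⟨hr0, hw, hc⟩ := hr i hi
  have := h.pos_other i hi j hj h1 h2
  rw [hw, hc, linForm_smul, eval_mul, eval_C, ← edgeForm, eval_edgeForm] at this
  exact (pos_iff_pos_of_mul_pos this).1 hr0

theorem IsPolygonData.orient_side_pos {m : ℕ} {v w : ℕ → Fin 2 → ℝ} {c : ℕ → ℝ}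
    (h : IsPolygonData m v w c) {i j : ℕ} (hi : i + 1 < m) (hj : j < m) (h1 : j ≠ i)
    (h2 : j ≠ i + 1) : 0 < orient (v i) (v (i + 1)) (v j) := by
  have e : (i + 1 + m - 1) % m = i := by
    rw [show i + 1 + m - 1 = i + m by omega, Nat.add_mod_right, Nat.mod_eq_of_lt (by omega)]
  have := h.orient_pos hi hj (by omega) h2
  rwa [e] at this

theorem IsPolygonData.orient_closing_pos {m : ℕ} {v w : ℕ → Fin 2 → ℝ} {c : ℕ → ℝ}
    (h : IsPolygonData m v w c) {j : ℕ} (h0 : 0 < j) (hj : j + 1 < m) :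
    0 < orient (v (m - 1)) (v 0) (v j) := by
  have e : (0 + m - 1) % m = m - 1 := by rw [zero_add]; exact Nat.mod_eq_of_lt (by omega)
  have := h.orient_pos (i := 0) (j := j) (by omega) (by omega) (by omega) (by omega)
  rwa [e] at this

theorem IsAdjointOf.exists_eq_fan {k : ℕ} {v : ℕ → Fin 2 → ℝ} {p : MvPolynomial (Fin 2) ℝ}
    (h : IsAdjointOf (k + 3) v p) : ∃ r : ℝ, 0 < r ∧ p = C r * fan v (k + 1) := by
  obtain ⟨w, c, hd, rfl⟩ := h
  obtain ⟨r, hr⟩ := hd.exists_scaling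
  refine ⟨∏ i ∈ Finset.range (k + 3), r i,
    Finset.prod_pos fun i hi => (hr i (Finset.mem_range.1 hi)).1, ?_⟩
  rw [← adjPoly_edgeNormal]
  exact adjPoly_smul _ (by omega) r _ _ _ _ (fun i hi => (hr i hi).2.1) fun i hi => (hr i hi).2.2

/-- A line having a polygon on its closed left side has the interior on its open left side. -/
theorem orient_pos_of_mem_interior {p q a : Fin 2 → ℝ} {s : Set (Fin 2 → ℝ)}
    (hs : ∀ x ∈ s, 0 ≤ orient p q x) (hpq : p ≠ q) (ha : a ∈ interior (convexHull ℝ s)) :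
    0 < orient p q a := by
  have hconv : Convex ℝ {x | 0 ≤ orient p q x} := by
    intro x hx y hy α β hα hβ hαβ
    simp only [Set.mem_ofPred_eq] at *
    have : orient p q (α • x + β • y) = α * orient p q x + β * orient p q y := by
      simp [orient]
      linear_combination (p 0 * q 1 - p 1 * q 0) * (-hαβ)
    rw [this]
    positivity
  have hsub : convexHull ℝ s ⊆ {x | 0 ≤ orient p q x} := convexHull_min hs hconv
  have hcont : Continuous fun t : ℝ => a - t • edgeNormal p q := by fun_prop
  have hev : ∀ᶠ t in nhds (0 : ℝ), a - t • edgeNormal p q ∈ interior (convexHull ℝ s) :=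
    hcont.continuousAt.eventually (isOpen_interior.mem_nhds (by simpa using ha))
  obtain ⟨ε, hε, hball⟩ := Metric.eventually_nhds_iff.1 hev
  have h := hsub (interior_subset (hball (y := ε / 2) (by
    rw [Real.dist_eq, sub_zero, abs_of_pos (by positivity)]; linarith)))
  have e : orient p q (a - (ε / 2) • edgeNormal p q) =
      orient p q a - ε / 2 * ((p 1 - q 1) ^ 2 + (q 0 - p 0) ^ 2) := by
    simp [orient, edgeNormal]; ring
  rw [Set.mem_ofPred_eq, e] at h
  have hd := normSq_edgeNormal_pos hpq
  nlinarith [mul_pos (half_pos hε) hd]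

section Positivity

variable {n : ℕ} {v : ℕ → Fin 2 → ℝ} {a : Fin 2 → ℝ}

theorem eval_chainSum_nonneg
    (hS : ∀ i j, i + 1 < n → j < n → j ≠ i → j ≠ i + 1 → 0 < orient (v i) (v (i + 1)) (v j))
    (ha : ∀ i, i + 1 < n → 0 < eval a (side v i)) (k : ℕ) (hk : k + 2 ≤ n) :
    0 ≤ eval a (chainSum v k) := by
  induction k with
  | zero => simp [chainSum]
  | succ k ih =>
    simp only [chainSum, map_add, map_mul, map_prod, eval_C]
    refine add_nonneg (mul_nonneg (ih (by omega)) (ha _ (by omega)).le)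
      (mul_nonneg (hS _ _ (by omega) (by omega) (by omega) (by omega)).le ?_)
    refine Finset.prod_nonneg fun j hj => (ha _ ?_).le
    have := Finset.mem_range.1 hj
    omega

theorem eval_fan_pos_of_diag_nonneg
    (hS : ∀ i j, i + 1 < n → j < n → j ≠ i → j ≠ i + 1 → 0 < orient (v i) (v (i + 1)) (v j))
    (hD : ∀ i j, 0 < i → i < j → j < n → 0 < orient (v 0) (v i) (v j))
    (ha : ∀ i, i + 1 < n → 0 < eval a (side v i)) (k : ℕ) (hk : k + 3 ≤ n)
    (hd : 0 ≤ eval a (diag v (k + 2))) : 0 < eval a (fan v (k + 1)) := by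
  simp only [fan, map_add, map_mul, map_prod, eval_C]
  refine add_pos (add_pos_of_nonneg_of_pos
    (mul_nonneg (eval_chainSum_nonneg hS ha _ (by omega)) hd)
    (mul_pos (hS _ _ (by omega) (by omega) (by omega) (by omega)) ?_)) (mul_pos ?_ ?_)
  · refine Finset.prod_pos fun j hj => ha _ ?_
    have := Finset.mem_range.1 hj
    omega
  · rw [orient_rotate]
    exact hD _ _ (by omega) (by omega) (by omega)
  · refine Finset.prod_pos fun j hj => ha _ ?_
    have := Finset.mem_range.1 hj
    omega

theorem eval_diag_succ_pos
    (hD : ∀ i j, 0 < i → i < j → j < n → 0 < orient (v 0) (v i) (v j))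
    (ha : ∀ i, i + 1 < n → 0 < eval a (side v i)) (j : ℕ) (hj : j + 3 < n)
    (hd : 0 ≤ eval a (diag v (j + 2))) : 0 < eval a (diag v (j + 3)) := by
  have h0 := ha 0 (by omega)
  rw [side, eval_edgeForm] at h0
  rw [diag, eval_edgeForm] at *
  have h1 := hD (j + 2) (j + 3) (by omega) (by omega) hj
  have h2 := hD 1 (j + 3) (by omega) (by omega) hj
  have h3 := hD 1 (j + 2) (by omega) (by omega) (by omega)
  have e : orient (v (j + 3)) (v 0) a * orient (v 0) (v 1) (v (j + 2)) =
      orient (v (j + 2)) (v 0) a * orient (v 0) (v 1) (v (j + 3)) +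
        orient (v 0) (v (0 + 1)) a * orient (v 0) (v (j + 2)) (v (j + 3)) := by
    simp only [orient, zero_add]; ring
  refine (pos_iff_pos_of_mul_pos (b := orient (v 0) (v 1) (v (j + 2))) ?_).2 h3
  rw [e]
  exact add_pos_of_nonneg_of_pos (mul_nonneg hd h2.le) (mul_pos h0 h1)

/-- All adjoints of the fan subpolygons are positive in the interior of the whole polygon. -/
theorem eval_fan_pos
    (hS : ∀ i j, i + 1 < n → j < n → j ≠ i → j ≠ i + 1 → 0 < orient (v i) (v (i + 1)) (v j))
    (hD : ∀ i j, 0 < i → i < j → j < n → 0 < orient (v 0) (v i) (v j))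
    (ha : ∀ i, i + 1 < n → 0 < eval a (side v i)) (k : ℕ) (hk : k + 3 ≤ n) :
    0 < eval a (fan v (k + 1)) := by
  induction k with
  | zero =>
    rw [fan_one, eval_C]
    exact pow_pos (hD 1 2 (by omega) (by omega) (by omega)) 2
  | succ k ih =>
    rcases le_or_gt 0 (eval a (diag v (k + 3))) with h | h
    · exact eval_fan_pos_of_diag_nonneg hS hD ha _ hk h
    · have h' : eval a (diag v (k + 2)) < 0 := by
        by_contra hc
        exact absurd (eval_diag_succ_pos hD ha k (by omega) (not_lt.1 hc)) (not_lt.2 h.le)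
      have e := congrArg (eval a) (fan_succ_mul_diag v (k + 1))
      simp only [map_sub, map_mul, map_prod, eval_C] at e
      have hneg : eval a (fan v (k + 1 + 1)) * eval a (diag v (k + 2)) < 0 := by
        rw [e]
        have h1 := mul_pos (ih (by omega)) (ha (k + 2) (by omega))
        have h2 : 0 < area v (k + 1) ^ 2 * ∏ j ∈ Finset.range (k + 1 + 1), eval a (side v j) := by
          refine mul_pos (pow_pos (hD _ _ (by omega) (by omega) (by omega)) 2)
            (Finset.prod_pos fun j hj => ha _ ?_)
          have := Finset.mem_range.1 hj
          omega
        have h3 := mul_neg_of_pos_of_neg h1 h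
        simp only [add_assoc, Nat.reduceAdd] at *
        linarith
      exact pos_of_mul_neg_left hneg h'.le

end Positivity

/-- Diagonal entries of the determinantal representation. -/
noncomputable def reprDiag (v : ℕ → Fin 2 → ℝ) (k : ℕ) : MvPolynomial (Fin 2) ℝ :=
  C ((area v k ^ 2)⁻¹) * diagEntry v k

/-- Off-diagonal entries of the determinantal representation. -/
noncomputable def reprOff (v : ℕ → Fin 2 → ℝ) (k : ℕ) : MvPolynomial (Fin 2) ℝ :=
  C (area v (k + 2) / area v (k + 1)) * side v (k + 2)

theorem fan_recurrence (v : ℕ → Fin 2 → ℝ) (k : ℕ) (h1 : area v (k + 1) ≠ 0)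
    (h2 : area v (k + 2) ≠ 0) :
    fan v (k + 3) = reprDiag v (k + 1) * fan v (k + 2) - reprOff v k ^ 2 * fan v (k + 1) := by
  have hC : (C (area v (k + 1) ^ 2) : MvPolynomial (Fin 2) ℝ) ≠ 0 := by simpa using h1
  refine mul_left_cancel₀ hC ?_
  rw [area_mul_fan v (k + 1) h2, reprDiag, reprOff, mul_pow, ← C_pow, div_pow]
  have e1 : (C (area v (k + 1) ^ 2) : MvPolynomial (Fin 2) ℝ) * C ((area v (k + 1) ^ 2)⁻¹) = 1 := by
    rw [← C_mul, mul_inv_cancel₀ (pow_ne_zero 2 h1), C_1]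
  rw [div_eq_mul_inv, C_mul]
  linear_combination (-diagEntry v (k + 1) * fan v (k + 2) +
    C (area v (k + 2) ^ 2) * side v (k + 2) ^ 2 * fan v (k + 1)) * e1

theorem fan_two (v : ℕ → Fin 2 → ℝ) (h0 : area v 0 ≠ 0) (h1 : area v 1 ≠ 0) :
    fan v 2 = reprDiag v 0 * fan v 1 := by
  have hC : (C (area v 0 ^ 2) : MvPolynomial (Fin 2) ℝ) ≠ 0 := by simpa using h0
  refine mul_left_cancel₀ hC ?_
  rw [area_mul_fan v 0 h1, reprDiag, fan_zero]
  have e1 : (C (area v 0 ^ 2) : MvPolynomial (Fin 2) ℝ) * C ((area v 0 ^ 2)⁻¹) = 1 := by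
    rw [← C_mul, mul_inv_cancel₀ (pow_ne_zero 2 h0), C_1]
  linear_combination (-diagEntry v 0 * fan v 1) * e1

theorem det_tridiag_mul_fan_one (v : ℕ → Fin 2 → ℝ) (k : ℕ) (h : ∀ i ≤ k, area v i ≠ 0) :
    (tridiag (reprDiag v) (reprOff v) k).det * fan v 1 = fan v (k + 1) := by
  induction k using Nat.twoStepInduction with
  | zero => simp
  | one =>
    rw [fan_two v (h 0 (by omega)) (h 1 le_rfl), Matrix.det_fin_one]
    rfl
  | more k ih1 ih2 =>
    rw [det_tridiag_add_two, fan_recurrence v k (h _ (by omega)) (h _ (by omega)),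
      ← ih1 fun i hi => h i (by omega), ← ih2 fun i hi => h i (by omega)]
    ring

theorem totalDegree_C_mul_le (r : ℝ) {p : MvPolynomial (Fin 2) ℝ} (hp : p.totalDegree ≤ 1) :
    (C r * p).totalDegree ≤ 1 :=
  (totalDegree_mul _ _).trans (by rwa [totalDegree_C, zero_add])

theorem totalDegree_tridiagEntry_repr_le (v : ℕ → Fin 2 → ℝ) (i j : ℕ) :
    (tridiagEntry (reprDiag v) (reprOff v) i j).totalDegree ≤ 1 := by
  unfold tridiagEntry
  split_ifs
  · exact totalDegree_C_mul_le _ (totalDegree_diagEntry_le v i)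
  · exact totalDegree_C_mul_le _ (totalDegree_linForm_le _ _)
  · exact totalDegree_C_mul_le _ (totalDegree_linForm_le _ _)
  · simp

theorem stmt_4 (n : ℕ) (hn : 4 ≤ n) (v : ℕ → Fin 2 → ℝ)
    (A : Fin (n - 3) → MvPolynomial (Fin 2) ℝ)
    (hA : ∀ k : Fin (n - 3), IsAdjointOf (k.val + 4) v (A k)) :
    ∃ (M : Matrix (Fin (n - 3)) (Fin (n - 3)) (MvPolynomial (Fin 2) ℝ))
      (c : Fin (n - 3) → ℝ),
      (∀ k, c k ≠ 0) ∧
      M.IsSymm ∧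
      (∀ i j, (M i j).totalDegree ≤ 1) ∧
      (∀ i j : Fin (n - 3), (i.val + 2 ≤ j.val ∨ j.val + 2 ≤ i.val) → M i j = 0) ∧
      (∀ k : Fin (n - 3),
        (M.submatrix (Fin.castLE k.isLt) (Fin.castLE k.isLt)).det = C (c k) * A k) ∧
      (∀ a ∈ interior (convexHull ℝ (v '' {i | i < n})),
        (M.map (fun p => eval a p)).PosDef) := by
  have hS : ∀ i j, i + 1 < n → j < n → j ≠ i → j ≠ i + 1 →
      0 < orient (v i) (v (i + 1)) (v j) := by
    intro i j hi hj h1 h2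
    obtain ⟨w, c, hd, -⟩ := hA ⟨n - 4, by omega⟩
    exact hd.orient_side_pos (by dsimp only; omega) (by dsimp only; omega) h1 h2
  have hD : ∀ i j, 0 < i → i < j → j < n → 0 < orient (v 0) (v i) (v j) := by
    intro i j hi hij hj
    rcases Nat.lt_or_ge j 3 with h3 | h3
    · obtain ⟨rfl, rfl⟩ : i = 1 ∧ j = 2 := by omega
      exact hS 0 2 (by omega) hj (by omega) (by omega)
    · obtain ⟨w, c, hd, -⟩ := hA ⟨j - 3, by omega⟩
      have := hd.orient_closing_pos hi (by dsimp only; omega)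
      dsimp only at this
      rwa [show j - 3 + 4 - 1 = j by omega, orient_rotate] at this
  have harea : ∀ i ≤ n - 3, area v i ≠ 0 := fun i hi =>
    (hD (i + 1) (i + 2) (by omega) (by omega) (by omega)).ne'
  have hfan : ∀ k : Fin (n - 3), ∃ r : ℝ, 0 < r ∧ A k = C r * fan v (k + 2) := fun k =>
    (hA k).exists_eq_fan
  choose r hr0 hr using hfan
  have ha0 : 0 < area v 0 ^ 2 := pow_pos (hD 1 2 (by omega) (by omega) (by omega)) 2
  refine ⟨tridiag (reprDiag v) (reprOff v) (n - 3), fun k => (area v 0 ^ 2 * r k)⁻¹,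
    fun k => inv_ne_zero (mul_pos ha0 (hr0 k)).ne', tridiag_isSymm _ _ _,
    fun i j => totalDegree_tridiagEntry_repr_le v i j, ?_, ?_, ?_⟩
  · rintro i j (h | h)
    · exact tridiagEntry_of_lt _ _ (by omega)
    · rw [tridiag_apply, tridiagEntry_symm]
      exact tridiagEntry_of_lt _ _ (by omega)
  · intro k
    have hdet := det_tridiag_mul_fan_one v (k + 1) fun i hi => harea i (by omega)
    have hsub : (tridiag (reprDiag v) (reprOff v) (n - 3)).submatrix (Fin.castLE k.isLt)
        (Fin.castLE k.isLt) = tridiag (reprDiag v) (reprOff v) (k + 1) := rfl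
    rw [hsub, hr k]
    rw [fan_one] at hdet
    have e : (C ((area v 0 ^ 2 * r k)⁻¹) : MvPolynomial (Fin 2) ℝ) * C (r k) * C (area v 0 ^ 2) =
        1 := by
      rw [← C_mul, ← C_mul, mul_assoc, mul_comm (r k),
        inv_mul_cancel₀ (mul_pos ha0 (hr0 k)).ne', C_1]
    rw [← hdet]
    linear_combination -(tridiag (reprDiag v) (reprOff v) (k + 1)).det * e
  · intro a ha
    have hside : ∀ i, i + 1 < n → 0 < eval a (side v i) := by
      intro i hi
      rw [side, eval_edgeForm]
      refine orient_pos_of_mem_interior ?_ ?_ ha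
      · rintro _ ⟨j, hj, rfl⟩
        rcases eq_or_ne j i with rfl | h1
        · apply le_of_eq; unfold orient; ring
        rcases eq_or_ne j (i + 1) with rfl | h2
        · apply le_of_eq; unfold orient; ring
        exact (hS i j hi hj h1 h2).le
      · intro heq
        obtain ⟨j, hj, h1, h2⟩ : ∃ j < n, j ≠ i ∧ j ≠ i + 1 := by
          rcases Nat.eq_zero_or_pos i with h | h
          · exact ⟨2, by omega, by omega, by omega⟩
          · exact ⟨0, by omega, by omega, by omega⟩
        have := hS i j hi hj h1 h2
        rw [heq] at this
        have e : orient (v (i + 1)) (v (i + 1)) (v j) = 0 := by unfold orient; ring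
        exact this.ne' e
    have hmap : (tridiag (reprDiag v) (reprOff v) (n - 3)).map (fun p => eval a p) =
        tridiag (fun i => eval a (reprDiag v i)) (fun i => eval a (reprOff v i)) (n - 3) := by
      ext i j
      simp only [Matrix.map_apply, tridiag_apply, tridiagEntry]
      split_ifs <;> simp
    rw [hmap]
    refine tridiag_posDef _ _ (fun k => eval a (fan v (k + 1))) _ ?_ ?_ ?_
    · rw [fan_two v (harea 0 (by omega)) (harea 1 (by omega)), eval_mul]
    · intro i hi
      rw [fan_recurrence v i (harea _ (by omega)) (harea _ (by omega))]
      simp only [map_sub, map_mul, map_pow]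
    · intro i hi
      exact eval_fan_pos hS hD hside i (by omega)
end

section
/- Let P = conv(v_1,…,v_n), n ≥ 4, be a convex polygon as in the context with adjoint α_P. Let i, j be indices such that the edges e_i and e_j share no vertex (j ∉ {i−1, i, i+1} modulo n), such that w_i and w_j are linearly independent, and let q ∈ ℝ² be the unique common zero of l_i and l_j. Assume q is not a vertex of P and l_s(q) ≠ 0 for every s ∉ {i, j} (no third facet line passes through q). Let Q be the convex quadrilateral with vertices v_{i−1}, v_i, v_{j−1}, v_j (listed in counterclockwise order) and let α_Q be its adjoint, an affine-linear polynomial. Then α_P(q) = 0, the gradient ∇α_P(q) is nonzero, and there exists a nonzero real number λ such that α_Q(x) = λ · ⟨∇α_P(q), x − q⟩ for all x ∈ ℝ²; that is, the line {α_Q = 0} is the tangent line to the adjoint curve {α_P = 0} at q. -/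
open MvPolynomial

theorem pderiv_linForm (w : Fin 2 → ℝ) (c : ℝ) (k : Fin 2) :
    pderiv k (linForm w c) = C (w k) := by
  fin_cases k <;> simp [linForm, pderiv_X]

theorem succ_mod_cases {m r : ℕ} (hr : r < m) :
    (r + 1 < m ∧ (r + 1) % m = r + 1) ∨ (r + 1 = m ∧ (r + 1) % m = 0) := by
  rcases Nat.lt_or_ge (r + 1) m with h | h
  · exact .inl ⟨h, Nat.mod_eq_of_lt h⟩
  · obtain rfl : r + 1 = m := by omega
    exact .inr ⟨rfl, Nat.mod_self _⟩

theorem pred_mod_cases {m r : ℕ} (hr : r < m) :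
    (r = 0 ∧ (r + m - 1) % m = m - 1) ∨ (0 < r ∧ (r + m - 1) % m = r - 1) := by
  rcases Nat.eq_zero_or_pos r with rfl | h
  · exact .inl ⟨rfl, by rw [Nat.mod_eq_of_lt] <;> omega⟩
  · refine .inr ⟨h, ?_⟩
    rw [show r + m - 1 = (r - 1) + m by omega, Nat.add_mod_right, Nat.mod_eq_of_lt (by omega)]

theorem succ_pred_mod {m r : ℕ} (hr : r < m) : ((r + m - 1) % m + 1) % m = r := by
  have h := succ_mod_cases (Nat.mod_lt (r + m - 1) (by omega : 0 < m))
  have h' := pred_mod_cases hr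
  omega

theorem pred_succ_mod {m r : ℕ} (hr : r < m) : ((r + 1) % m + m - 1) % m = r := by
  have h := pred_mod_cases (Nat.mod_lt (r + 1) (by omega : 0 < m))
  have h' := succ_mod_cases hr
  omega

/-- The derivative of a product at a common zero of one of the factors. -/
theorem eval_pderiv_prod_linForm {w : ℕ → Fin 2 → ℝ} {c : ℕ → ℝ} {q : Fin 2 → ℝ}
    {T : Finset ℕ} {i : ℕ} (hi : i ∈ T) (hqi : eval q (linForm (w i) (c i)) = 0) (k : Fin 2) :
    eval q (pderiv k (∏ s ∈ T, linForm (w s) (c s))) =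
      w i k * ∏ s ∈ T.erase i, eval q (linForm (w s) (c s)) := by
  rw [← Finset.mul_prod_erase T _ hi, Derivation.leibniz]
  simp [hqi, pderiv_linForm, mul_comm]

/-- The difference of the reciprocal signed distances, scaled by the norm of `w`, from `q` to the
points `y` and `x` of a line through `q` with normal vector `w`. -/
noncomputable def edgeCoeff (w x y q : Fin 2 → ℝ) : ℝ :=
  (w 0 ^ 2 + w 1 ^ 2) * (1 / det2 w (q - y) - 1 / det2 w (q - x))

theorem normSq_mul_of_orthogonal {w z : Fin 2 → ℝ} (h : w 0 * z 0 + w 1 * z 1 = 0)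
    (u : Fin 2 → ℝ) :
    (w 0 ^ 2 + w 1 ^ 2) * (u 0 * z 0 + u 1 * z 1) = det2 w u * det2 w z := by
  simp only [det2]
  linear_combination (u 0 * w 0 + u 1 * w 1) * h

theorem normSq_pos_of_det2_ne_zero {w u : Fin 2 → ℝ} (h : det2 w u ≠ 0) :
    0 < w 0 ^ 2 + w 1 ^ 2 := by
  by_contra! hle
  have h0 : w 0 = 0 := by nlinarith [sq_nonneg (w 0), sq_nonneg (w 1)]
  have h1 : w 1 = 0 := by nlinarith [sq_nonneg (w 0), sq_nonneg (w 1)]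
  exact h (by simp [det2, h0, h1])

/-- For a point `q` on the line of `(w, c)`, the value at `q` of a second form through a point
`x` of that line. -/
theorem normSq_mul_eval_linForm {w u x q : Fin 2 → ℝ} {c d : ℝ}
    (hx : eval x (linForm w c) = 0) (hq : eval q (linForm w c) = 0)
    (hux : eval x (linForm u d) = 0) :
    (w 0 ^ 2 + w 1 ^ 2) * eval q (linForm u d) = det2 w u * det2 w (q - x) := by
  rw [eval_linForm] at *
  rw [← normSq_mul_of_orthogonal (z := q - x) (by simp; linarith) u]
  simp only [Pi.sub_apply]
  linear_combination (w 0 ^ 2 + w 1 ^ 2) * hux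

theorem det2_swap (u w : Fin 2 → ℝ) : det2 u w = -det2 w u := by
  simp [det2]; ring

/-- Data of an edge of a polygon from `x` to `y` with form `(w, c)`, with preceding form
`(u, d)` and following form `(u', d')`, and a point `q` of its line. -/
structure EdgeAt (w u u' : Fin 2 → ℝ) (c d d' : ℝ) (x y q : Fin 2 → ℝ) : Prop where
  left : eval x (linForm w c) = 0
  right : eval y (linForm w c) = 0
  base : eval q (linForm w c) = 0
  prev_left : eval x (linForm u d) = 0
  next_right : eval y (linForm u' d') = 0
  next_left : eval x (linForm u' d') ≠ 0
  det_prev : det2 u w ≠ 0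
  det_next : det2 w u' ≠ 0

namespace EdgeAt

variable {w u u' x y q : Fin 2 → ℝ} {c d d' : ℝ}

theorem normSq_pos (h : EdgeAt w u u' c d d' x y q) : 0 < w 0 ^ 2 + w 1 ^ 2 :=
  normSq_pos_of_det2_ne_zero h.det_next

theorem det2_left_ne_zero_iff (h : EdgeAt w u u' c d d' x y q) :
    det2 w (q - x) ≠ 0 ↔ eval q (linForm u d) ≠ 0 := by
  have e := normSq_mul_eval_linForm h.left h.base h.prev_left
  have hw := h.normSq_pos.ne'
  have hd : det2 w u ≠ 0 := by rw [det2_swap]; exact neg_ne_zero.2 h.det_prev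
  exact ⟨fun hx h0 => mul_ne_zero hd hx (by rw [← e, h0, mul_zero]),
    fun hu h0 => mul_ne_zero hw hu (by rw [e, h0, mul_zero])⟩

theorem det2_right_ne_zero_iff (h : EdgeAt w u u' c d d' x y q) :
    det2 w (q - y) ≠ 0 ↔ eval q (linForm u' d') ≠ 0 := by
  have e := normSq_mul_eval_linForm h.right h.base h.next_right
  have hw := h.normSq_pos.ne'
  exact ⟨fun hy h0 => mul_ne_zero h.det_next hy (by rw [← e, h0, mul_zero]),
    fun hu h0 => mul_ne_zero hw hu (by rw [e, h0, mul_zero])⟩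

theorem det2_edge_ne_zero (h : EdgeAt w u u' c d d' x y q) : det2 w (x - y) ≠ 0 := by
  have e := normSq_mul_eval_linForm h.right h.left h.next_right
  intro h0
  rw [h0, mul_zero] at e
  exact (mul_ne_zero h.normSq_pos.ne' h.next_left) e

theorem edgeCoeff_eq (h : EdgeAt w u u' c d d' x y q) (hu : eval q (linForm u d) ≠ 0)
    (hu' : eval q (linForm u' d') ≠ 0) :
    det2 u w / eval q (linForm u d) + det2 w u' / eval q (linForm u' d') =
      edgeCoeff w x y q := by
  have e := normSq_mul_eval_linForm h.left h.base h.prev_left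
  have e' := normSq_mul_eval_linForm h.right h.base h.next_right
  have hx := h.det2_left_ne_zero_iff.2 hu
  have hy := h.det2_right_ne_zero_iff.2 hu'
  have h1 : det2 u w / eval q (linForm u d) = -(w 0 ^ 2 + w 1 ^ 2) / det2 w (q - x) := by
    rw [div_eq_div_iff hu hx, det2_swap]
    linear_combination e
  have h2 : det2 w u' / eval q (linForm u' d') = (w 0 ^ 2 + w 1 ^ 2) / det2 w (q - y) := by
    rw [div_eq_div_iff hu' hy]
    linear_combination -e'
  rw [h1, h2, edgeCoeff]
  ring

theorem edgeCoeff_ne_zero (h : EdgeAt w u u' c d d' x y q) (hu : eval q (linForm u d) ≠ 0)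
    (hu' : eval q (linForm u' d') ≠ 0) : edgeCoeff w x y q ≠ 0 := by
  have hx := h.det2_left_ne_zero_iff.2 hu
  have hy := h.det2_right_ne_zero_iff.2 hu'
  refine mul_ne_zero h.normSq_pos.ne' ?_
  rw [div_sub_div _ _ hy hx]
  refine div_ne_zero (fun h0 => h.det2_edge_ne_zero ?_) (mul_ne_zero hy hx)
  simp only [det2, Pi.sub_apply] at h0 ⊢
  linarith

/-- Any second nonconstant form vanishing at both ends of an edge is proportional to its form. -/
theorem exists_smul (h : EdgeAt w u u' c d d' x y q) {a s : Fin 2 → ℝ} {b : ℝ}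
    (hx : eval x (linForm a b) = 0) (hy : eval y (linForm a b) = 0) (has : det2 a s ≠ 0) :
    ∃ r : ℝ, r ≠ 0 ∧ a = r • w := by
  have hN := h.normSq_pos.ne'
  have e := normSq_mul_eval_linForm h.right h.left hy
  rw [hx, mul_zero] at e
  have h0 : det2 w a = 0 := by simpa [h.det2_edge_ne_zero] using e.symm
  have ha : a = ((w 0 * a 0 + w 1 * a 1) / (w 0 ^ 2 + w 1 ^ 2)) • w := by
    simp only [det2] at h0
    ext k
    fin_cases k
    · simp only [Fin.zero_eta, Pi.smul_apply, smul_eq_mul]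
      field_simp
      linear_combination -w 1 * h0
    · simp only [Fin.mk_one, Pi.smul_apply, smul_eq_mul]
      field_simp
      linear_combination w 0 * h0
  refine ⟨_, fun hr => has ?_, ha⟩
  rw [hr, zero_smul] at ha
  simp [ha, det2]

end EdgeAt

theorem det2_smul_left (r : ℝ) (w z : Fin 2 → ℝ) : det2 (r • w) z = r * det2 w z := by
  simp [det2]; ring

theorem edgeCoeff_smul {r : ℝ} (hr : r ≠ 0) (w x y q : Fin 2 → ℝ) :
    edgeCoeff (r • w) x y q = r * edgeCoeff w x y q := by
  simp only [edgeCoeff, det2_smul_left, Pi.smul_apply, smul_eq_mul, one_div, mul_inv]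
  field_simp

theorem IsPolygonData.edgeAt {m : ℕ} {v w : ℕ → Fin 2 → ℝ} {c : ℕ → ℝ}
    (hP : IsPolygonData m v w c) {i : ℕ} (hi : i < m) {q : Fin 2 → ℝ}
    (hq : eval q (linForm (w i) (c i)) = 0) :
    EdgeAt (w i) (w ((i + m - 1) % m)) (w ((i + 1) % m)) (c i) (c ((i + m - 1) % m))
      (c ((i + 1) % m)) (v ((i + m - 1) % m)) (v i) q := by
  have hm := hP.three_le
  have hp : (i + m - 1) % m < m := Nat.mod_lt _ (by omega)
  have hs : (i + 1) % m < m := Nat.mod_lt _ (by omega)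
  refine ⟨hP.vanish_prev i hi, hP.vanish_self i hi, hq, hP.vanish_self _ hp, ?_, ?_, ?_,
    (hP.ccw i hi).ne'⟩
  · simpa [pred_succ_mod hi] using hP.vanish_prev _ hs
  · have h1 := succ_mod_cases hi
    have h2 := pred_mod_cases hi
    refine (hP.pos_other _ hs _ hp ?_ ?_).ne'
    · rw [pred_succ_mod hi]
      omega
    · omega
  · simpa [succ_pred_mod hi] using (hP.ccw _ hp).ne'

theorem eval_adjPoly_eq_zero {m : ℕ} {w : ℕ → Fin 2 → ℝ} {c : ℕ → ℝ} {i j : ℕ}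
    (hi : i < m) (hj : j < m) (hjj : j ≠ i) (hji : j ≠ (i + m - 1) % m)
    (hjk : j ≠ (i + 1) % m) {q : Fin 2 → ℝ} (hqi : eval q (linForm (w i) (c i)) = 0)
    (hqj : eval q (linForm (w j) (c j)) = 0) : eval q (adjPoly m w c) = 0 := by
  rw [adjPoly, map_sum]
  refine Finset.sum_eq_zero fun r hr => ?_
  rw [Finset.mem_range] at hr
  rw [map_mul, eval_prod]
  refine mul_eq_zero_of_right _ ?_
  have hrc := succ_mod_cases hr
  have hic := succ_mod_cases hi
  have hip := pred_mod_cases hi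
  by_cases h : i = r ∨ i = (r + 1) % m
  · refine Finset.prod_eq_zero (i := j) ?_ hqj
    simp only [Finset.mem_erase, Finset.mem_range]
    omega
  · refine Finset.prod_eq_zero (i := i) ?_ hqi
    simp only [Finset.mem_erase, Finset.mem_range]
    omega

/-- The gradient of the adjoint at the intersection of two nonadjacent facet lines. -/
theorem IsPolygonData.eval_pderiv_adjPoly {m : ℕ} {v w : ℕ → Fin 2 → ℝ} {c : ℕ → ℝ}
    (hP : IsPolygonData m v w c) {i j : ℕ}
    (hi : i < m) (hj : j < m) (hjj : j ≠ i) (hji : j ≠ (i + m - 1) % m)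
    (hjk : j ≠ (i + 1) % m) {q : Fin 2 → ℝ} (hqi : eval q (linForm (w i) (c i)) = 0)
    (hqj : eval q (linForm (w j) (c j)) = 0)
    (hq : ∀ s < m, s ≠ i → s ≠ j → eval q (linForm (w s) (c s)) ≠ 0) (k : Fin 2) :
    eval q (pderiv k (adjPoly m w c)) =
      (∏ s ∈ ((Finset.range m).erase i).erase j, eval q (linForm (w s) (c s))) *
        (edgeCoeff (w i) (v ((i + m - 1) % m)) (v i) q * w j k +
          edgeCoeff (w j) (v ((j + m - 1) % m)) (v j) q * w i k) := by
  have hm := hP.three_le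
  have hic := succ_mod_cases hi
  have hip := pred_mod_cases hi
  have hjc := succ_mod_cases hj
  have hjp := pred_mod_cases hj
  have hspi := succ_pred_mod hi
  have hspj := succ_pred_mod hj
  rw [← (hP.edgeAt hi hqi).edgeCoeff_eq (hq _ (by omega) (by omega) (by omega))
      (hq _ (by omega) (by omega) (by omega)),
    ← (hP.edgeAt hj hqj).edgeCoeff_eq (hq _ (by omega) (by omega) (by omega))
      (hq _ (by omega) (by omega) (by omega))]
  set pi := (i + m - 1) % m
  set pj := (j + m - 1) % m
  set ni := (i + 1) % m with hni
  set nj := (j + 1) % m with hnj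
  rw [adjPoly, map_sum, map_sum]
  simp only [pderiv_C_mul, map_mul, eval_C]
  have key : ∀ a b r t, ((a = i ∧ b = j) ∨ (a = j ∧ b = i)) →
      ((r = a ∧ t ≠ a) ∨ (t = a ∧ r ≠ a)) → r < m → t < m → r ≠ b → t ≠ b → r ≠ t →
      ∀ s, ((s = t ∧ r = a) ∨ (s = r ∧ t = a)) →
      eval q (pderiv k (∏ p ∈ ((Finset.range m).erase r).erase t, linForm (w p) (c p))) =
        w b k * ((∏ p ∈ ((Finset.range m).erase i).erase j, eval q (linForm (w p) (c p))) /
          eval q (linForm (w s) (c s))) := by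
    intro a b r t hab hra hr ht hrb htb hrt s hs
    have hqb : eval q (linForm (w b) (c b)) = 0 := by
      rcases hab with ⟨-, rfl⟩ | ⟨-, rfl⟩ <;> assumption
    rw [eval_pderiv_prod_linForm (i := b) (by simp; omega) hqb]
    congr 1
    have hs0 := hq s (by omega) (by omega) (by omega)
    have hmem : s ∈ ((Finset.range m).erase i).erase j := by simp; omega
    rw [← Finset.mul_prod_erase _ _ hmem, mul_div_cancel_left₀ _ hs0]
    refine Finset.prod_congr ?_ fun _ _ => rfl
    ext p
    simp only [Finset.mem_erase, Finset.mem_range]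
    omega
  have hsub : ({pi, i, pj, j} : Finset ℕ) ⊆ Finset.range m := by
    intro r
    simp only [Finset.mem_insert, Finset.mem_singleton, Finset.mem_range]
    omega
  rw [← Finset.sum_subset hsub]
  · rw [Finset.sum_insert (by simp; omega), Finset.sum_insert (by simp; omega),
      Finset.sum_insert (by simp; omega), Finset.sum_singleton, hspi, hspj, ← hni, ← hnj,
      key i j pi i (by omega) (by omega) (by omega) (by omega) (by omega) (by omega) (by omega)
        pi (by omega),
      key i j i ni (by omega) (by omega) (by omega) (by omega) (by omega) (by omega) (by omega)
        ni (by omega),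
      key j i pj j (by omega) (by omega) (by omega) (by omega) (by omega) (by omega) (by omega)
        pj (by omega),
      key j i j nj (by omega) (by omega) (by omega) (by omega) (by omega) (by omega) (by omega)
        nj (by omega)]
    ring
  · intro r hr hr'
    simp only [Finset.mem_insert, Finset.mem_singleton, Finset.mem_range, not_or] at hr hr'
    have hrc := succ_mod_cases hr
    rw [eval_pderiv_prod_linForm (i := i) (by simp; omega) hqi,
      Finset.prod_eq_zero (i := j) (by simp; omega) hqj]
    ring

/-- The adjoint of a quadrilateral, expanded at the intersection `q` of two opposite edges. -/
theorem eval_adjPoly_four {w : ℕ → Fin 2 → ℝ} {c : ℕ → ℝ} {q : Fin 2 → ℝ}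
    (h1 : eval q (linForm (w 1) (c 1)) = 0) (h3 : eval q (linForm (w 3) (c 3)) = 0)
    (x : Fin 2 → ℝ) :
    eval x (adjPoly 4 w c) =
      (det2 (w 0) (w 1) * eval q (linForm (w 2) (c 2)) +
        det2 (w 1) (w 2) * eval q (linForm (w 0) (c 0))) *
          (w 3 0 * (x 0 - q 0) + w 3 1 * (x 1 - q 1)) +
      (det2 (w 2) (w 3) * eval q (linForm (w 0) (c 0)) +
        det2 (w 3) (w 0) * eval q (linForm (w 2) (c 2))) *
          (w 1 0 * (x 0 - q 0) + w 1 1 * (x 1 - q 1)) := by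
  have e0 : ((Finset.range 4).erase 0).erase 1 = {2, 3} := by decide
  have e1 : ((Finset.range 4).erase 1).erase 2 = {0, 3} := by decide
  have e2 : ((Finset.range 4).erase 2).erase 3 = {0, 1} := by decide
  have e3 : ((Finset.range 4).erase 3).erase 0 = {1, 2} := by decide
  have h : adjPoly 4 w c =
      C (det2 (w 0) (w 1)) * (linForm (w 2) (c 2) * linForm (w 3) (c 3)) +
      C (det2 (w 1) (w 2)) * (linForm (w 0) (c 0) * linForm (w 3) (c 3)) +
      C (det2 (w 2) (w 3)) * (linForm (w 0) (c 0) * linForm (w 1) (c 1)) +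
      C (det2 (w 3) (w 0)) * (linForm (w 1) (c 1) * linForm (w 2) (c 2)) := by
    rw [adjPoly, Finset.sum_range_succ, Finset.sum_range_succ, Finset.sum_range_succ,
      Finset.sum_range_succ, Finset.sum_range_zero, zero_add]
    norm_num only [e0, e1, e2, e3]
    simp
  rw [h]
  simp only [map_add, map_mul, eval_C, eval_linForm] at h1 h3 ⊢
  have hc1 : c 1 = -(w 1 0 * q 0 + w 1 1 * q 1) := by linarith
  have hc3 : c 3 = -(w 3 0 * q 0 + w 3 1 * q 1) := by linarith
  simp only [hc1, hc3, det2]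
  ring

theorem stmt_6 (n : ℕ) (hn : 4 ≤ n) (v w : ℕ → Fin 2 → ℝ) (c : ℕ → ℝ)
    (hP : IsPolygonData n v w c)
    (i j : ℕ) (hi : i < n) (hj : j < n)
    (hji : j ≠ (i + n - 1) % n) (hjj : j ≠ i) (hjk : j ≠ (i + 1) % n)
    (hindep : det2 (w i) (w j) ≠ 0)
    (q : Fin 2 → ℝ)
    (hqi : eval q (linForm (w i) (c i)) = 0)
    (hqj : eval q (linForm (w j) (c j)) = 0)
    (hqvert : ∀ s < n, q ≠ v s)
    (hqline : ∀ s < n, s ≠ i → s ≠ j → eval q (linForm (w s) (c s)) ≠ 0)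
    (αQ : MvPolynomial (Fin 2) ℝ)
    (hQ : IsAdjointOf 4
      (fun t => if t = 0 then v ((i + n - 1) % n) else if t = 1 then v i
        else if t = 2 then v ((j + n - 1) % n) else v j) αQ) :
    eval q (adjPoly n w c) = 0 ∧
    (eval q (pderiv 0 (adjPoly n w c)) ≠ 0 ∨ eval q (pderiv 1 (adjPoly n w c)) ≠ 0) ∧
    ∃ lam : ℝ, lam ≠ 0 ∧ ∀ x : Fin 2 → ℝ,
      eval x αQ =
        lam * (eval q (pderiv 0 (adjPoly n w c)) * (x 0 - q 0) +
               eval q (pderiv 1 (adjPoly n w c)) * (x 1 - q 1)) := by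
  have hic := succ_mod_cases hi
  have hip := pred_mod_cases hi
  have hjc := succ_mod_cases hj
  have hjp := pred_mod_cases hj
  obtain ⟨w', c', hQ', rfl⟩ := hQ
  have Ei := hP.edgeAt hi hqi
  have Ej := hP.edgeAt hj hqj
  have hpi := hqline ((i + n - 1) % n) (by omega) (by omega) (by omega)
  have hni := hqline ((i + 1) % n) (by omega) (by omega) (by omega)
  have hpj := hqline ((j + n - 1) % n) (by omega) (by omega) (by omega)
  have hnj := hqline ((j + 1) % n) (by omega) (by omega) (by omega)
  have hA := Ei.edgeCoeff_ne_zero hpi hni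
  have hgrad := hP.eval_pderiv_adjPoly hi hj hjj hji hjk hqi hqj hqline
  have hprod : ∏ s ∈ ((Finset.range n).erase i).erase j, eval q (linForm (w s) (c s)) ≠ 0 := by
    refine Finset.prod_ne_zero_iff.2 fun s hs => ?_
    simp only [Finset.mem_erase, Finset.mem_range] at hs
    exact hqline s hs.2.2 hs.2.1 hs.1
  refine ⟨eval_adjPoly_eq_zero hi hj hjj hji hjk hqi hqj, ?_, ?_⟩
  · by_contra! h0
    rw [hgrad, hgrad] at h0
    obtain ⟨h0, h1⟩ := h0
    replace h0 := (mul_eq_zero.1 h0).resolve_left hprod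
    replace h1 := (mul_eq_zero.1 h1).resolve_left hprod
    refine mul_ne_zero hA hindep ?_
    simp only [det2]
    linear_combination w i 0 * h1 - w i 1 * h0
  · have x1 : eval (v ((i + n - 1) % n)) (linForm (w' 1) (c' 1)) = 0 := by
      simpa using hQ'.vanish_prev 1 (by norm_num)
    have y1 : eval (v i) (linForm (w' 1) (c' 1)) = 0 := by
      simpa using hQ'.vanish_self 1 (by norm_num)
    have x3 : eval (v ((j + n - 1) % n)) (linForm (w' 3) (c' 3)) = 0 := by
      simpa using hQ'.vanish_prev 3 (by norm_num)
    have y3 : eval (v j) (linForm (w' 3) (c' 3)) = 0 := by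
      simpa using hQ'.vanish_self 3 (by norm_num)
    obtain ⟨a, ha, hwa⟩ := Ei.exists_smul x1 y1 (hQ'.ccw 1 (by norm_num)).ne'
    obtain ⟨b, hb, hwb⟩ := Ej.exists_smul x3 y3 (hQ'.ccw 3 (by norm_num)).ne'
    have q1 : eval q (linForm (w' 1) (c' 1)) = 0 := by
      have h1 := Ei.left
      rw [hwa] at x1 ⊢
      simp only [eval_linForm, Pi.smul_apply, smul_eq_mul] at *
      linear_combination x1 + a * hqi - a * h1
    have q3 : eval q (linForm (w' 3) (c' 3)) = 0 := by
      have h1 := Ej.left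
      rw [hwb] at x3 ⊢
      simp only [eval_linForm, Pi.smul_apply, smul_eq_mul] at *
      linear_combination x3 + b * hqj - b * h1
    have E1 := hQ'.edgeAt (i := 1) (by norm_num) q1
    have E3 := hQ'.edgeAt (i := 3) (by norm_num) q3
    norm_num at E1 E3
    have L0 : eval q (linForm (w' 0) (c' 0)) ≠ 0 := by
      rw [← E1.det2_left_ne_zero_iff, hwa, det2_smul_left]
      exact mul_ne_zero ha (Ei.det2_left_ne_zero_iff.2 hpi)
    have L2 : eval q (linForm (w' 2) (c' 2)) ≠ 0 := by
      rw [← E1.det2_right_ne_zero_iff, hwa, det2_smul_left]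
      exact mul_ne_zero ha (Ei.det2_right_ne_zero_iff.2 hni)
    have A1 := E1.edgeCoeff_eq L0 L2
    have A3 := E3.edgeCoeff_eq L2 L0
    rw [div_add_div _ _ L0 L2, div_eq_iff (mul_ne_zero L0 L2)] at A1
    rw [div_add_div _ _ L2 L0, div_eq_iff (mul_ne_zero L2 L0)] at A3
    rw [show edgeCoeff (w' 1) _ _ q = _ from hwa ▸ edgeCoeff_smul ha _ _ _ _] at A1
    rw [show edgeCoeff (w' 3) _ _ q = _ from hwb ▸ edgeCoeff_smul hb _ _ _ _] at A3
    refine ⟨a * b * (eval q (linForm (w' 0) (c' 0)) * eval q (linForm (w' 2) (c' 2))) /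
        ∏ s ∈ ((Finset.range n).erase i).erase j, eval q (linForm (w s) (c s)),
      div_ne_zero (mul_ne_zero (mul_ne_zero ha hb) (mul_ne_zero L0 L2)) hprod, fun x => ?_⟩
    rw [eval_adjPoly_four q1 q3, hgrad, hgrad]
    have B0 := congrFun hwa 0
    have B1 := congrFun hwa 1
    have C0 := congrFun hwb 0
    have C1 := congrFun hwb 1
    simp only [Pi.smul_apply, smul_eq_mul] at B0 B1 C0 C1
    rw [B0, B1, C0, C1]
    field_simp
    linear_combination (b * (w j 0 * (x 0 - q 0) + w j 1 * (x 1 - q 1))) * A1 +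
      (a * (w i 0 * (x 0 - q 0) + w i 1 * (x 1 - q 1))) * A3
end
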